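/- arXiv:cs/0606053 — 3 statements merged into one kernel-verified Lean document; each statement's English description precedes it below -/
import Mathlib

section
/- For every rational graph G and every pair of rational sets I and F of vertices, there exist a rational graph G', a single vertex i, and a rational set F' such that L(G,I,F) = L(G',{i},F'); moreover, if G is a synchronized rational graph then G' can be chosen to be a synchronized rational graph. -/
/-!  Common definitions: transducers, rational graphs, regular languages,
pictures and tiling systems, following Carayol & Meyer,
"Context-Sensitive Languages, Rational Graphs and Determinism". -/

/-- A set of words is regular (rational) if it is recognized by a finite automaton. -/
def Regular {Γ : Type} (L : Set (List Γ)) : Prop :=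
  ∃ (Q : Type) (_ : Fintype Q) (M : DFA Γ Q), M.accepts = L

/-- A finite transducer over the alphabet `Γ`: a finite automaton whose
transitions are labeled by pairs in `(Γ ∪ {ε}) × (Γ ∪ {ε})`,
where `none` encodes the empty word ε. -/
structure Transducer (Γ : Type) where
  /-- states -/
  Q : Type
  /-- the set of states is finite -/
  fintypeQ : Fintype Q
  /-- initial state -/
  init : Q
  /-- final states -/
  final : Set Q
  /-- transition relation -/
  trans : Q → Option Γ × Option Γ → Q → Prop

namespace Transducer

variable {Γ : Type}

/-- Paths in a transducer, recording the list of transition labels. -/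
inductive Path (T : Transducer Γ) : T.Q → List (Option Γ × Option Γ) → T.Q → Prop
  | nil (q : T.Q) : Path T q [] q
  | cons {q q' q'' : T.Q} {l : Option Γ × Option Γ} {ls : List (Option Γ × Option Γ)} :
      T.trans q l q' → Path T q' ls q'' → Path T q (l :: ls) q''

/-- Input word of a list of transition labels (concatenation of first components). -/
def ins (ls : List (Option Γ × Option Γ)) : List Γ := ls.flatMap fun l => l.1.toList

/-- Output word of a list of transition labels (concatenation of second components). -/
def outs (ls : List (Option Γ × Option Γ)) : List Γ := ls.flatMap fun l => l.2.toList

/-- The binary relation on `Γ*` recognized by the transducer: pairs `(u,v)`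
obtained by concatenating componentwise the labels along an accepting run. -/
def Accepts (T : Transducer Γ) (u v : List Γ) : Prop :=
  ∃ (q : T.Q) (ls : List (Option Γ × Option Γ)),
    T.Path T.init ls q ∧ q ∈ T.final ∧ ins ls = u ∧ outs ls = v

/-- A transducer is synchronous if all its transitions are labeled by pairs
of letters of `Γ` (no ε). -/
def Synchronous (T : Transducer Γ) : Prop :=
  ∀ (q q' : T.Q) (l : Option Γ × Option Γ), T.trans q l q' → l.1.isSome ∧ l.2.isSome

/-- A transducer is (left-)synchronized if every path from the initial state
consists of a prefix of transitions labeled by pairs of letters of `Γ`,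
followed by transitions which are all ε on the input side, or all ε on the
output side. -/
def Synchronized (T : Transducer Γ) : Prop :=
  ∀ (q : T.Q) (ls : List (Option Γ × Option Γ)), T.Path T.init ls q →
    ∃ k : ℕ, (∀ l ∈ ls.take k, l.1.isSome ∧ l.2.isSome) ∧
      ((∀ l ∈ ls.drop k, l.1 = none) ∨ (∀ l ∈ ls.drop k, l.2 = none))

/-- A transducer is sequential if for any two transitions from a common state,
either they coincide, or their input letters are distinct letters of `Γ`. -/
def Sequential (T : Transducer Γ) : Prop :=
  ∀ (q q' q'' : T.Q) (x y x' y' : Option Γ),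
    T.trans q (x, y) q' → T.trans q (x', y') q'' →
    (x = x' ∧ y = y' ∧ q' = q'') ∨ (x ≠ none ∧ x' ≠ none ∧ x ≠ x')

/-- A transducer is deterministic if no two distinct transitions from the same
state carry the same label. -/
def Deterministic (T : Transducer Γ) : Prop :=
  ∀ (q q' q'' : T.Q) (l : Option Γ × Option Γ),
    T.trans q l q' → T.trans q l q'' → q' = q''

end Transducer

/-- A rational graph labeled by the alphabet `A` with vertices in `Γ*`,
given by one transducer over `Γ` per label. -/
structure RationalGraph (A Γ : Type) where
  /-- the transducer defining the edges labeled by a given letter -/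
  trans : A → Transducer Γ

namespace RationalGraph

variable {A Γ : Type}

/-- There is an edge `u →a v` iff `(u,v)` is recognized by the transducer `T_a`. -/
def Edge (G : RationalGraph A Γ) (u : List Γ) (a : A) (v : List Γ) : Prop :=
  (G.trans a).Accepts u v

/-- A synchronous rational graph is defined by synchronous transducers. -/
def Synchronous (G : RationalGraph A Γ) : Prop := ∀ a : A, (G.trans a).Synchronous

/-- A synchronized rational graph is defined by synchronized transducers. -/
def Synchronized (G : RationalGraph A Γ) : Prop := ∀ a : A, (G.trans a).Synchronized

/-- A sequential rational graph is defined by sequential transducers. -/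
def Sequential (G : RationalGraph A Γ) : Prop := ∀ a : A, (G.trans a).Sequential

/-- `vs` is the sequence of vertices of a path labeled by the word `w`. -/
def IsPath (G : RationalGraph A Γ) (vs : List (List Γ)) (w : List A) : Prop :=
  vs.length = w.length + 1 ∧
  ∀ (k : ℕ) (a : A) (u v : List Γ),
    w[k]? = some a → vs[k]? = some u → vs[k + 1]? = some v → G.Edge u a v

/-- The path language of `G` between the sets of vertices `I` and `F`:
all words labeling a path from a vertex of `I` to a vertex of `F`. -/
def Lang (G : RationalGraph A Γ) (I F : Set (List Γ)) : Set (List A) :=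
  { w | ∃ (vs : List (List Γ)) (i f : List Γ), G.IsPath vs w ∧
      vs.head? = some i ∧ i ∈ I ∧ vs.getLast? = some f ∧ f ∈ F }

/-- A graph has finite out-degree if every vertex has finitely many outgoing edges. -/
def FiniteOutDegree (G : RationalGraph A Γ) : Prop :=
  ∀ u : List Γ, { p : A × List Γ | G.Edge u p.1 p.2 }.Finite

/-- The out-degree of a vertex: the number of its outgoing edges. -/
noncomputable def outDegree (G : RationalGraph A Γ) (u : List Γ) : ℕ :=
  { p : A × List Γ | G.Edge u p.1 p.2 }.ncard

/-- Two vertices are adjacent if some edge (in either direction, ignoring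
labels) connects them. -/
def Adj (G : RationalGraph A Γ) (u v : List Γ) : Prop :=
  (∃ a, G.Edge u a v) ∨ (∃ a, G.Edge v a u)

end RationalGraph

/-- `chainN R n u v` holds iff there is a sequence of `n` `R`-steps from `u` to `v`. -/
def chainN {α : Type} (R : α → α → Prop) : ℕ → α → α → Prop
  | 0, u, v => u = v
  | n + 1, u, w => ∃ v, R u v ∧ chainN R n v w

/-- `IsDist R x v n` : the length of a shortest `R`-sequence from `x` to `v` is `n`. -/
def IsDist {α : Type} (R : α → α → Prop) (x v : α) (n : ℕ) : Prop :=
  chainN R n x v ∧ ∀ m : ℕ, chainN R m x v → n ≤ m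

/-- A 2×2 tile over the alphabet `Λ`. -/
structure Tile (Λ : Type) where
  /-- top-left letter -/
  tl : Λ
  /-- top-right letter -/
  tr : Λ
  /-- bottom-left letter -/
  bl : Λ
  /-- bottom-right letter -/
  br : Λ

/-- The set of 2×2 tiles appearing in a picture given as a list of rows. -/
def tilesOf {Λ : Type} (rows : List (List Λ)) : Set (Tile Λ) :=
  { t | ∃ (i j : ℕ) (r₁ r₂ : List Λ), rows[i]? = some r₁ ∧ rows[i + 1]? = some r₂ ∧
      r₁[j]? = some t.tl ∧ r₁[j + 1]? = some t.tr ∧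
      r₂[j]? = some t.bl ∧ r₂[j + 1]? = some t.br }

/-- The picture of width `m` framed by the border symbol `#` (encoded by `none`). -/
def framed {Λ : Type} (rows : List (List Λ)) (m : ℕ) : List (List (Option Λ)) :=
  List.replicate (m + 2) none ::
    (rows.map fun r => none :: (r.map some ++ [none])) ++
      [List.replicate (m + 2) none]

/-- A tiling system with input alphabet `A` and work alphabet `Λ`
(the frame symbol `#` is encoded by `none : Option Λ`). -/
structure TilingSystem (A Λ : Type) where
  /-- the embedding of the input alphabet into the work alphabet -/
  emb : A → Λ
  /-- the input alphabet is a sub-alphabet of the work alphabet -/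
  emb_inj : Function.Injective emb
  /-- the (finite, as `Λ` is finite) set of allowed tiles over `Λ ∪ {#}` -/
  tiles : Set (Tile (Option Λ))

namespace TilingSystem

variable {A Λ : Type}

/-- `S.Pic rows n m` : `rows` is an `(n,m)`-picture of the picture language of `S`,
i.e. all 2×2 tiles of the framed picture belong to the tiles of `S`. -/
def Pic (S : TilingSystem A Λ) (rows : List (List Λ)) (n m : ℕ) : Prop :=
  0 < n ∧ 0 < m ∧ rows.length = n ∧ (∀ r ∈ rows, r.length = m) ∧
    tilesOf (framed rows m) ⊆ S.tiles

/-- The word language of a tiling system: frontiers (first rows) of accepted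
pictures that are words over the input alphabet. -/
def Lang (S : TilingSystem A Λ) : Set (List A) :=
  { w | ∃ (rows : List (List Λ)) (n : ℕ),
      S.Pic rows n w.length ∧ rows.head? = some (w.map S.emb) }

/-- A tiling system is deterministic if each row determines at most one
possible next row. -/
def Deterministic (S : TilingSystem A Λ) : Prop :=
  ∀ u v v' : List (Option Λ), v.length = u.length → v'.length = u.length →
    tilesOf [none :: u ++ [none], none :: v ++ [none]] ⊆ S.tiles →
    tilesOf [none :: u ++ [none], none :: v' ++ [none]] ⊆ S.tiles → v = v'

end TilingSystem

namespace SingleInit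

open Transducer

variable {A Γ : Type}

/-- Recursive form of path reachability. -/
def Reach (G : RationalGraph A Γ) : List Γ → List A → List Γ → Prop
  | u, [], v => u = v
  | u, a :: w, v => ∃ x, G.Edge u a x ∧ Reach G x w v

theorem isPath_cons (G : RationalGraph A Γ) (u x : List Γ) (vs : List (List Γ)) (a : A)
    (w : List A) : G.IsPath (u :: x :: vs) (a :: w) ↔ G.Edge u a x ∧ G.IsPath (x :: vs) w := by
  constructor
  · rintro ⟨h1, h2⟩
    refine ⟨h2 0 a u x rfl rfl rfl, by simpa using h1, ?_⟩
    intro k b y z hb hy hz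
    exact h2 (k + 1) b y z (by simpa using hb) (by simpa using hy) (by simpa using hz)
  · rintro ⟨h1, h2, h3⟩
    refine ⟨by simpa using h2, ?_⟩
    intro k b y z hb hy hz
    cases k with
    | zero =>
      simp at hb hy hz
      subst hb hy hz
      exact h1
    | succ k => exact h3 k b y z (by simpa using hb) (by simpa using hy) (by simpa using hz)

theorem reach_iff (G : RationalGraph A Γ) (w : List A) : ∀ (u v : List Γ),
    Reach G u w v ↔ ∃ vs, G.IsPath vs w ∧ vs.head? = some u ∧ vs.getLast? = some v := by
  induction w with
  | nil =>
    intro u v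
    constructor
    · rintro rfl
      exact ⟨[u], ⟨rfl, by intro k a x y h; simp at h⟩, rfl, rfl⟩
    · rintro ⟨vs, ⟨h1, -⟩, h2, h3⟩
      obtain ⟨x, rfl⟩ := List.length_eq_one_iff.mp (by simpa using h1)
      simp at h2 h3
      exact h2.symm.trans h3
  | cons a w ih =>
    intro u v
    constructor
    · rintro ⟨x, hx, hr⟩
      obtain ⟨vs, hp, hh, hl⟩ := (ih x v).mp hr
      cases vs with
      | nil => simp at hh
      | cons y vs =>
        simp at hh
        subst hh
        exact ⟨u :: y :: vs, (isPath_cons G u y vs a w).mpr ⟨hx, hp⟩, rfl, by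
          simpa [List.getLast?_cons_cons] using hl⟩
    · rintro ⟨vs, hp, hh, hl⟩
      match vs, hp, hh, hl with
      | [], hp, hh, hl => simp at hh
      | [y], hp, hh, hl => exact absurd hp.1 (by simp)
      | y :: x :: vs, hp, hh, hl =>
        simp at hh
        subst hh
        obtain ⟨he, hp'⟩ := (isPath_cons G y x vs a w).mp hp
        exact ⟨x, he, (ih x v).mpr ⟨x :: vs, hp', rfl, by
          simpa [List.getLast?_cons_cons] using hl⟩⟩

theorem mem_lang (G : RationalGraph A Γ) (I F : Set (List Γ)) (w : List A) :
    w ∈ G.Lang I F ↔ ∃ u ∈ I, ∃ v ∈ F, Reach G u w v := by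
  constructor
  · rintro ⟨vs, i, f, hp, hi, hI, hf, hF⟩
    exact ⟨i, hI, f, hF, (reach_iff G w i f).mpr ⟨vs, hp, hi, hf⟩⟩
  · rintro ⟨i, hI, f, hF, hr⟩
    obtain ⟨vs, hp, hi, hf⟩ := (reach_iff G w i f).mp hr
    exact ⟨vs, i, f, hp, hi, hI, hf, hF⟩

/-- Encoding of the old vertices: prefix with the marker `none`. -/
def enc (u : List Γ) : List (Option Γ) := none :: u.map some

theorem enc_inj {u v : List Γ} (h : enc u = enc v) : u = v := by
  have hmap : u.map some = v.map some := by simpa [enc] using h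
  exact List.map_injective_iff.mpr (Option.some_injective Γ) hmap

/-- Transitions of the new transducer. -/
inductive Tr {S : Type} (T : Transducer Γ) (M : DFA Γ S) :
    Option (T.Q ⊕ T.Q × S) → Option (Option Γ) × Option (Option Γ) →
      Option (T.Q ⊕ T.Q × S) → Prop
  | start1 : Tr T M none (some none, some none) (some (Sum.inl T.init))
  | start2 : Tr T M none (none, some none) (some (Sum.inr (T.init, M.start)))
  | step1 {p q : T.Q} {l : Option Γ × Option Γ} : T.trans p l q →
      Tr T M (some (Sum.inl p)) (l.1.map some, l.2.map some) (some (Sum.inl q))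
  | step2 {p q : T.Q} {s : S} {l : Option Γ × Option Γ} : T.trans p l q →
      Tr T M (some (Sum.inr (p, s))) (none, l.2.map some)
        (some (Sum.inr (q, M.evalFrom s l.1.toList)))

/-- Final states of the new transducer. -/
def FinStates {S : Type} (T : Transducer Γ) (M : DFA Γ S) : Set (Option (T.Q ⊕ T.Q × S)) :=
  { x | (∃ q ∈ T.final, x = some (Sum.inl q)) ∨
    (∃ q ∈ T.final, ∃ s ∈ M.accept, x = some (Sum.inr (q, s))) }

/-- The new transducer. -/
noncomputable def newT {S : Type} [Fintype S] (T : Transducer Γ) (M : DFA Γ S) :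
    Transducer (Option Γ) where
  Q := Option (T.Q ⊕ T.Q × S)
  fintypeQ := by
    haveI := T.fintypeQ
    infer_instance
  init := none
  final := FinStates T M
  trans := Tr T M

/-- relabelling -/
def e1 (l : Option Γ × Option Γ) : Option (Option Γ) × Option (Option Γ) :=
  (l.1.map some, l.2.map some)

/-- relabelling, dropping inputs -/
def e2 (l : Option Γ × Option Γ) : Option (Option Γ) × Option (Option Γ) :=
  (none, l.2.map some)

section
variable {S : Type} [Fintype S] (T : Transducer Γ) (M : DFA Γ S)

theorem path1 {p q : T.Q} {ls : List (Option Γ × Option Γ)} (h : T.Path p ls q) :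
    (newT T M).Path (some (Sum.inl p)) (ls.map e1) (some (Sum.inl q)) := by
  induction h with
  | nil q => exact Path.nil _
  | cons ht _ ih => exact Path.cons (T := newT T M) (Tr.step1 ht) ih

theorem path2 {p q : T.Q} {ls : List (Option Γ × Option Γ)} (h : T.Path p ls q) : ∀ s : S,
    (newT T M).Path (some (Sum.inr (p, s))) (ls.map e2)
      (some (Sum.inr (q, M.evalFrom s (ins ls)))) := by
  induction h with
  | nil q => intro s; exact Path.nil (T := newT T M) _
  | cons ht _ ih =>
    rename_i l ls' _
    intro s
    have := Path.cons (T := newT T M) (Tr.step2 (s := s) ht) (ih _)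
    rw [← DFA.evalFrom_of_append] at this
    exact this

theorem path1_inv {p' r : (newT T M).Q} {ls} (h : (newT T M).Path p' ls r) :
    ∀ p : T.Q, p' = some (Sum.inl p) →
      ∃ q ls0, r = some (Sum.inl q) ∧ ls = ls0.map e1 ∧ T.Path p ls0 q := by
  induction h with
  | nil q => intro p hp; exact ⟨p, [], hp, rfl, Path.nil p⟩
  | cons ht _ ih =>
    intro p hp
    subst hp
    cases (show Tr T M _ _ _ from ht) with
    | step1 h1 =>
      obtain ⟨q, ls0, hr, hl, hq⟩ := ih _ rfl
      exact ⟨q, _ :: ls0, hr, by rw [hl]; rfl, Path.cons h1 hq⟩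

theorem path2_inv {p' r : (newT T M).Q} {ls} (h : (newT T M).Path p' ls r) :
    ∀ (p : T.Q) (s : S), p' = some (Sum.inr (p, s)) →
      ∃ q ls0, r = some (Sum.inr (q, M.evalFrom s (ins ls0))) ∧ ls = ls0.map e2 ∧
        T.Path p ls0 q := by
  induction h with
  | nil q => intro p s hp; exact ⟨p, [], hp, rfl, Path.nil p⟩
  | cons ht _ ih =>
    intro p s hp
    subst hp
    cases (show Tr T M _ _ _ from ht) with
    | step2 h1 =>
      rename_i l _
      obtain ⟨q, ls0, hr, hl, hq⟩ := ih _ _ rfl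
      refine ⟨q, l :: ls0, ?_, by rw [hl]; rfl, Path.cons h1 hq⟩
      rw [hr, ← DFA.evalFrom_of_append]
      rfl

theorem path_inv' {p' r : (newT T M).Q} {ls} (h : (newT T M).Path p' ls r)
    (hp : p' = none) :
    (ls = [] ∧ r = none) ∨
    (∃ q ls0, r = some (Sum.inl q) ∧ ls = (some none, some none) :: ls0.map e1 ∧
      T.Path T.init ls0 q) ∨
    (∃ q ls0, r = some (Sum.inr (q, M.evalFrom M.start (ins ls0))) ∧
      ls = (none, some none) :: ls0.map e2 ∧ T.Path T.init ls0 q) := by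
  cases h with
  | nil q => exact Or.inl ⟨rfl, hp⟩
  | cons ht h =>
    subst hp
    right
    cases (show Tr T M _ _ _ from ht) with
    | start1 =>
      left
      obtain ⟨q, ls0, hr, hl, hq⟩ := path1_inv T M h _ rfl
      exact ⟨q, ls0, hr, by rw [hl], hq⟩
    | start2 =>
      right
      obtain ⟨q, ls0, hr, hl, hq⟩ := path2_inv T M h _ _ rfl
      exact ⟨q, ls0, hr, by rw [hl], hq⟩

theorem path_inv {r : (newT T M).Q} {ls} (h : (newT T M).Path none ls r) :
    (ls = [] ∧ r = none) ∨
    (∃ q ls0, r = some (Sum.inl q) ∧ ls = (some none, some none) :: ls0.map e1 ∧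
      T.Path T.init ls0 q) ∨
    (∃ q ls0, r = some (Sum.inr (q, M.evalFrom M.start (ins ls0))) ∧
      ls = (none, some none) :: ls0.map e2 ∧ T.Path T.init ls0 q) :=
  path_inv' T M h rfl

theorem ins_e1 (ls : List (Option Γ × Option Γ)) : ins (ls.map e1) = (ins ls).map some := by
  induction ls with
  | nil => rfl
  | cons l ls ih =>
    rcases l with ⟨_ | x, y⟩ <;> simpa [ins, e1] using ih

theorem outs_e1 (ls : List (Option Γ × Option Γ)) : outs (ls.map e1) = (outs ls).map some := by
  induction ls with
  | nil => rfl
  | cons l ls ih =>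
    rcases l with ⟨x, _ | y⟩ <;> simpa [outs, e1] using ih

theorem outs_e2 (ls : List (Option Γ × Option Γ)) : outs (ls.map e2) = (outs ls).map some := by
  induction ls with
  | nil => rfl
  | cons l ls ih =>
    rcases l with ⟨x, _ | y⟩ <;> simpa [outs, e2] using ih

theorem ins_e2 (ls : List (Option Γ × Option Γ)) : ins (ls.map e2) = [] := by
  induction ls with
  | nil => rfl
  | cons l ls ih => exact ih

theorem accepts_iff (u' v' : List (Option Γ)) : (newT T M).Accepts u' v' ↔
    ∃ u v, T.Accepts u v ∧ v' = enc v ∧ (u' = enc u ∨ (u' = [] ∧ u ∈ M.accepts)) := by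
  constructor
  · rintro ⟨r, ls, hp, hr, rfl, rfl⟩
    have hr' : r ∈ FinStates T M := hr
    rcases path_inv T M hp with ⟨-, rfl⟩ | ⟨q, ls0, rfl, rfl, hq⟩ | ⟨q, ls0, rfl, rfl, hq⟩
    · rcases hr' with ⟨_, _, h⟩ | ⟨_, _, _, _, h⟩ <;> cases h
    · have hf : q ∈ T.final := by
        rcases hr' with ⟨_, hf, h⟩ | ⟨_, _, _, _, h⟩ <;> cases h
        exact hf
      refine ⟨ins ls0, outs ls0, ⟨q, ls0, hq, hf, rfl, rfl⟩, ?_, Or.inl ?_⟩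
      · rw [enc, ← outs_e1]; rfl
      · rw [enc, ← ins_e1]; rfl
    · have hf : q ∈ T.final ∧ M.evalFrom M.start (ins ls0) ∈ M.accept := by
        rcases hr' with ⟨_, _, h⟩ | ⟨_, hf, _, hs, h⟩ <;> cases h
        exact ⟨hf, hs⟩
      refine ⟨ins ls0, outs ls0, ⟨q, ls0, hq, hf.1, rfl, rfl⟩, ?_, Or.inr ⟨?_, hf.2⟩⟩
      · rw [enc, ← outs_e2]; rfl
      · rw [← ins_e2 ls0]; rfl
  · rintro ⟨u, v, ⟨q, ls0, hq, hf, rfl, rfl⟩, rfl, rfl | ⟨rfl, hu⟩⟩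
    · refine ⟨some (Sum.inl q), (some none, some none) :: ls0.map e1,
        Path.cons (T := newT T M) Tr.start1 (path1 T M hq), Or.inl ⟨q, hf, rfl⟩, ?_, ?_⟩
      · rw [enc, ← ins_e1]; rfl
      · rw [enc, ← outs_e1]; rfl
    · refine ⟨some (Sum.inr (q, M.evalFrom M.start (ins ls0))),
        (none, some none) :: ls0.map e2,
        Path.cons (T := newT T M) Tr.start2 (path2 T M hq _),
        Or.inr ⟨q, hf, _, hu, rfl⟩, ?_, ?_⟩
      · rw [← ins_e2 ls0]; rfl
      · rw [enc, ← outs_e2]; rfl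

theorem newT_sync (h : T.Synchronized) : (newT T M).Synchronized := by
  intro r ls hp
  rcases path_inv T M hp with ⟨rfl, -⟩ | ⟨q, ls0, -, rfl, hq⟩ | ⟨q, ls0, -, rfl, hq⟩
  · exact ⟨0, by simp, by simp⟩
  · obtain ⟨k, h1, h2⟩ := h q ls0 hq
    refine ⟨k + 1, ?_, ?_⟩
    · intro l hl
      rw [List.take_succ_cons, ← List.map_take, List.mem_cons, List.mem_map] at hl
      rcases hl with rfl | ⟨l0, hl0, rfl⟩
      · simp
      · simpa [e1] using h1 l0 hl0
    · rw [List.drop_succ_cons, ← List.map_drop]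
      rcases h2 with h2 | h2
      · left
        intro l hl
        obtain ⟨l0, hl0, rfl⟩ := List.mem_map.mp hl
        simp [e1, h2 l0 hl0]
      · right
        intro l hl
        obtain ⟨l0, hl0, rfl⟩ := List.mem_map.mp hl
        simp [e1, h2 l0 hl0]
  · refine ⟨0, by simp, Or.inl ?_⟩
    intro l hl
    rw [List.drop_zero, List.mem_cons, List.mem_map] at hl
    rcases hl with rfl | ⟨l0, _, rfl⟩ <;> rfl

end

/-- The new graph. -/
noncomputable def newG {S : Type} [Fintype S] (G : RationalGraph A Γ) (M : DFA Γ S) :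
    RationalGraph A (Option Γ) := ⟨fun a => newT (G.trans a) M⟩

section
variable {S : Type} [Fintype S] (G : RationalGraph A Γ) (M : DFA Γ S)

theorem reach_enc (w : List A) : ∀ (u : List Γ) (v' : List (Option Γ)),
    Reach (newG G M) (enc u) w v' ↔ ∃ v, v' = enc v ∧ Reach G u w v := by
  induction w with
  | nil =>
    intro u v'
    constructor
    · rintro rfl
      exact ⟨u, rfl, rfl⟩
    · rintro ⟨v, rfl, rfl⟩
      rfl
  | cons a w ih =>
    intro u v'
    constructor
    · rintro ⟨x', hx, hr⟩
      obtain ⟨y, x, hyx, rfl, hy | ⟨hy, -⟩⟩ := (accepts_iff (G.trans a) M _ _).mp hx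
      · cases enc_inj hy
        obtain ⟨v, rfl, hv⟩ := (ih x v').mp hr
        exact ⟨v, rfl, x, hyx, hv⟩
      · simp [enc] at hy
    · rintro ⟨v, rfl, x, hx, hr⟩
      exact ⟨enc x, (accepts_iff (G.trans a) M _ _).mpr ⟨u, x, hx, rfl, Or.inl rfl⟩,
        (ih x _).mpr ⟨v, rfl, hr⟩⟩

theorem reach_init (a : A) (w : List A) (v' : List (Option Γ)) :
    Reach (newG G M) [] (a :: w) v' ↔
      ∃ u ∈ M.accepts, ∃ v, v' = enc v ∧ Reach G u (a :: w) v := by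
  constructor
  · rintro ⟨x', hx, hr⟩
    obtain ⟨y, x, hyx, rfl, hy | ⟨-, hy⟩⟩ := (accepts_iff (G.trans a) M _ _).mp hx
    · simp [enc] at hy
    · obtain ⟨v, rfl, hv⟩ := (reach_enc G M w x v').mp hr
      exact ⟨y, hy, v, rfl, x, hyx, hv⟩
  · rintro ⟨u, hu, v, rfl, x, hx, hr⟩
    exact ⟨enc x, (accepts_iff (G.trans a) M _ _).mpr ⟨u, x, hx, rfl, Or.inr ⟨rfl, hu⟩⟩,
        (reach_enc G M w x _).mpr ⟨v, rfl, hr⟩⟩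

end

/-- The new set of final vertices. -/
def newF (b : Prop) (F : Set (List Γ)) : Set (List (Option Γ)) :=
  { x | (x = [] ∧ b) ∨ ∃ v ∈ F, x = enc v }

/-- transition function of the automaton for the final set -/
def fstep {S : Type} (M : DFA Γ S) : Option (Option S) → Option Γ → Option (Option S)
  | none, none => some (some M.start)
  | some (some q), some x => some (some (M.step q x))
  | _, _ => some none

/-- automaton for the final set -/
def finDFA {S : Type} (M : DFA Γ S) (b : Prop) : DFA (Option Γ) (Option (Option S)) where
  step := fstep M
  start := none
  accept := { x | (x = none ∧ b) ∨ ∃ q ∈ M.accept, x = some (some q) }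

theorem finDFA_sink {S : Type} (M : DFA Γ S) (b : Prop) (v : List (Option Γ)) :
    (finDFA M b).evalFrom (some none) v = some none := by
  induction v with
  | nil => rfl
  | cons x v ih => exact ih

theorem finDFA_run {S : Type} (M : DFA Γ S) (b : Prop) (v : List (Option Γ)) : ∀ q : S,
    (finDFA M b).evalFrom (some (some q)) v ∈ (finDFA M b).accept ↔
      ∃ u : List Γ, v = u.map some ∧ M.evalFrom q u ∈ M.accept := by
  induction v with
  | nil =>
    intro q
    constructor
    · rintro (⟨h, -⟩ | ⟨q', hq', h⟩)
      · cases h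
      · cases h
        exact ⟨[], rfl, hq'⟩
    · rintro ⟨u, hu, h⟩
      obtain rfl : u = [] := by simpa using hu.symm
      exact Or.inr ⟨q, h, rfl⟩
  | cons x v ih =>
    intro q
    cases x with
    | none =>
      have h0 : (finDFA M b).evalFrom (some (some q)) (none :: v) = some none :=
        finDFA_sink M b v
      rw [h0]
      constructor
      · rintro (⟨h, -⟩ | ⟨q', hq', h⟩) <;> cases h
      · rintro ⟨u, hu, h⟩
        cases u <;> simp at hu
    | some x =>
      refine (ih (M.step q x)).trans ?_
      constructor
      · rintro ⟨u, rfl, h⟩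
        exact ⟨x :: u, rfl, h⟩
      · rintro ⟨u, hu, h⟩
        cases u with
        | nil => simp at hu
        | cons y u =>
          simp at hu
          obtain ⟨rfl, rfl⟩ := hu
          exact ⟨u, rfl, h⟩

theorem newF_regular (b : Prop) {F : Set (List Γ)} (hF : Regular F) : Regular (newF b F) := by
  obtain ⟨S, hS, M, rfl⟩ := hF
  refine ⟨Option (Option S), inferInstance, finDFA M b, ?_⟩
  ext v
  change (finDFA M b).evalFrom none v ∈ (finDFA M b).accept ↔ _
  rcases v with _ | ⟨_ | x, v⟩
  · constructor
    · rintro (⟨-, h⟩ | ⟨q', hq', h⟩)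
      · exact Or.inl ⟨rfl, h⟩
      · cases h
    · rintro (⟨-, h⟩ | ⟨q', hq', h⟩)
      · exact Or.inl ⟨rfl, h⟩
      · simp [enc] at h
  · refine (finDFA_run M b v M.start).trans ?_
    constructor
    · rintro ⟨u, rfl, h⟩
      exact Or.inr ⟨u, h, rfl⟩
    · rintro (⟨h, -⟩ | ⟨u, hu, h⟩)
      · cases h
      · exact ⟨u, by simpa [enc] using h, hu⟩
  · have h0 : (finDFA M b).evalFrom none (some x :: v) = some none := finDFA_sink M b v
    rw [h0]
    constructor
    · rintro (⟨h, -⟩ | ⟨q', hq', h⟩) <;> cases h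
    · rintro (⟨h, -⟩ | ⟨u, hu, h⟩)
      · cases h
      · simp [enc] at h

end SingleInit

/-- For every rational graph `G` and rational sets `I`, `F`, there are
a rational graph `G'`, a single vertex `i` and a rational set `F'` with
`L(G,I,F) = L(G',{i},F')`; moreover if `G` is synchronized then `G'` can be chosen
synchronized. -/
theorem rational_single_initial_vertex {A Γ : Type} [Fintype A] [Fintype Γ]
    (G : RationalGraph A Γ) (I F : Set (List Γ)) (hI : Regular I) (hF : Regular F) :
    ∃ (Γ' : Type) (_ : Fintype Γ') (G' : RationalGraph A Γ') (i : List Γ')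
      (F' : Set (List Γ')),
      Regular F' ∧ G.Lang I F = G'.Lang {i} F' ∧
        (G.Synchronized → G'.Synchronized) := by
  obtain ⟨S, hS, M, rfl⟩ := hI
  refine ⟨Option Γ, inferInstance, SingleInit.newG G M, [],
    SingleInit.newF (∃ u ∈ M.accepts, u ∈ F) F, SingleInit.newF_regular _ hF, ?_, ?_⟩
  · ext w
    refine (SingleInit.mem_lang G _ F w).trans (Iff.trans ?_ (SingleInit.mem_lang _ _ _ w).symm)
    cases w with
    | nil =>
      constructor
      · rintro ⟨u, hu, v, hv, rfl⟩
        exact ⟨[], rfl, [], Or.inl ⟨rfl, u, hu, hv⟩, rfl⟩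
      · rintro ⟨u, rfl, v, hv, rfl⟩
        rcases hv with ⟨-, u, hu, hF⟩ | ⟨v, hv, h⟩
        · exact ⟨u, hu, u, hF, rfl⟩
        · simp [SingleInit.enc] at h
    | cons a w =>
      constructor
      · rintro ⟨u, hu, v, hv, hr⟩
        exact ⟨[], rfl, SingleInit.enc v, Or.inr ⟨v, hv, rfl⟩,
          (SingleInit.reach_init G M a w _).mpr ⟨u, hu, v, rfl, hr⟩⟩
      · rintro ⟨u, rfl, v', hv, hr⟩
        obtain ⟨u, hu, v, rfl, hr2⟩ := (SingleInit.reach_init G M a w _).mp hr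
        rcases hv with ⟨h, -⟩ | ⟨v0, hv0, h⟩
        · simp [SingleInit.enc] at h
        · cases SingleInit.enc_inj h
          exact ⟨u, hu, v, hv0, hr2⟩
  · intro h a
    exact SingleInit.newT_sync (G.trans a) M (h a)
end

section
/- For every synchronous rational graph G and all rational sets I and F of vertices with I ∩ F = ∅, there exist a rational graph H of finite out-degree and a single vertex i such that L(G,I,F) = L(H,{i},F). -/
namespace SyncFin

/-- Paths for a labeled relation. -/
def conn {A V : Type} (R : V → A → V → Prop) : List A → V → V → Prop
  | [], u, v => u = v
  | a :: w, u, v => ∃ u', R u a u' ∧ conn R w u' v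

theorem conn_append {A V : Type} (R : V → A → V → Prop) (w w' : List A) (u v : V) :
    conn R (w ++ w') u v ↔ ∃ m, conn R w u m ∧ conn R w' m v := by
  induction w generalizing u with
  | nil => simp [conn]
  | cons a w ih =>
    simp only [List.cons_append, conn, ih]
    constructor
    · rintro ⟨x, h, m, h1, h2⟩; exact ⟨m, ⟨x, h, h1⟩, h2⟩
    · rintro ⟨m, ⟨x, h, h1⟩, h2⟩; exact ⟨x, h, m, h1, h2⟩

theorem isPath_conn {A Γ : Type} (G : RationalGraph A Γ) (w : List A) (u f : List Γ) :
    (∃ vs, G.IsPath vs w ∧ vs.head? = some u ∧ vs.getLast? = some f) ↔ conn G.Edge w u f := by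
  induction w generalizing u with
  | nil =>
    constructor
    · rintro ⟨vs, ⟨hl, -⟩, h1, h2⟩
      match vs, hl with
      | [x], _ => simp at h1 h2; subst h1; subst h2; rfl
    · rintro rfl
      exact ⟨[u], ⟨rfl, by simp⟩, rfl, rfl⟩
  | cons a w ih =>
    constructor
    · rintro ⟨vs, ⟨hl, hp⟩, h1, h2⟩
      match vs, hl with
      | x :: y :: vs, hl =>
        simp at h1; subst h1
        refine ⟨y, hp 0 a x y rfl rfl rfl, (ih y).1 ⟨y :: vs, ⟨by simpa using hl, ?_⟩, rfl, by simpa using h2⟩⟩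
        intro k b p q hk hp' hq
        exact hp (k + 1) b p q (by simpa using hk) (by simpa using hp') (by simpa using hq)
    · rintro ⟨y, he, hc⟩
      obtain ⟨vs, ⟨hl, hp⟩, h1, h2⟩ := (ih y).2 hc
      match vs, hl, h1 with
      | z :: vs, hl, h1 =>
        simp at h1; subst h1
        refine ⟨u :: z :: vs, ⟨by simpa using hl, ?_⟩, rfl, by simpa using h2⟩
        intro k b p q hk hp' hq
        match k with
        | 0 => simp at hk hp' hq; subst hk; subst hp'; subst hq; exact he
        | k + 1 => exact hp k b p q (by simpa using hk) (by simpa using hp') (by simpa using hq)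

theorem mem_lang {A Γ : Type} (G : RationalGraph A Γ) (I F : Set (List Γ)) (w : List A) :
    w ∈ G.Lang I F ↔ ∃ i ∈ I, ∃ f ∈ F, conn G.Edge w i f := by
  constructor
  · rintro ⟨vs, i, f, hp, h1, hi, h2, hf⟩
    exact ⟨i, hi, f, hf, (isPath_conn G w i f).1 ⟨vs, hp, h1, h2⟩⟩
  · rintro ⟨i, hi, f, hf, hc⟩
    obtain ⟨vs, hp, h1, h2⟩ := (isPath_conn G w i f).2 hc
    exact ⟨vs, i, f, hp, h1, hi, h2, hf⟩

/-- Acceptance of a pair of words of the same length by a letter-to-letter automaton. -/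
def sacc {X Γ : Type} (δ : X → Γ → Γ → X → Prop) (fin : X → Prop) :
    X → List Γ → List Γ → Prop
  | s, [], [] => fin s
  | s, x :: u, y :: v => ∃ t, δ s x y t ∧ sacc δ fin t u v
  | _, [], _ :: _ => False
  | _, _ :: _, [] => False

theorem sacc_length {X Γ : Type} {δ : X → Γ → Γ → X → Prop} {fin : X → Prop}
    {s : X} {u v : List Γ} (h : sacc δ fin s u v) : u.length = v.length := by
  induction u generalizing s v with
  | nil => cases v with
    | nil => rfl
    | cons => exact h.elim
  | cons x u ih => cases v with
    | nil => exact h.elim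
    | cons y v =>
      obtain ⟨t, -, h⟩ := h
      simp [ih h]

theorem sacc_comp {X Y Γ : Type} (δ : X → Γ → Γ → X → Prop) (fin : X → Prop)
    (δ' : Y → Γ → Γ → Y → Prop) (fin' : Y → Prop) (s : X) (t : Y) (u v : List Γ) :
    sacc (fun (p : X × Y) x y p' => ∃ z, δ p.1 x z p'.1 ∧ δ' p.2 z y p'.2)
      (fun p => fin p.1 ∧ fin' p.2) (s, t) u v ↔
    ∃ m, sacc δ fin s u m ∧ sacc δ' fin' t m v := by
  induction u generalizing s t v with
  | nil =>
    cases v with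
    | nil =>
      constructor
      · intro h; exact ⟨[], h⟩
      · rintro ⟨m, h1, h2⟩
        cases m with
        | nil => exact ⟨h1, h2⟩
        | cons => exact h1.elim
    | cons y v =>
      constructor
      · intro h; exact h.elim
      · rintro ⟨m, h1, h2⟩
        cases m with
        | nil => exact h2.elim
        | cons => exact h1.elim
  | cons x u ih =>
    cases v with
    | nil =>
      constructor
      · intro h; exact h.elim
      · rintro ⟨m, h1, h2⟩
        cases m with
        | nil => exact h1.elim
        | cons => exact h2.elim
    | cons y v =>
      constructor
      · rintro ⟨⟨s', t'⟩, ⟨z, hz1, hz2⟩, h⟩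
        obtain ⟨m, h1, h2⟩ := (ih _ _ _).1 h
        exact ⟨z :: m, ⟨s', hz1, h1⟩, ⟨t', hz2, h2⟩⟩
      · rintro ⟨m, h1, h2⟩
        cases m with
        | nil => exact h1.elim
        | cons z m =>
          obtain ⟨s', hz1, h1⟩ := h1
          obtain ⟨t', hz2, h2⟩ := h2
          exact ⟨(s', t'), ⟨z, hz1, hz2⟩, (ih _ _ _).2 ⟨m, h1, h2⟩⟩

theorem sacc_shorten {X Γ : Type} [Fintype X] (δ : X → Γ → Γ → X → Prop) (fin : X → Prop)
    (s : X) (u v : List Γ) (h : sacc δ fin s u v) :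
    ∃ u' v', sacc δ fin s u' v' ∧ u'.length < Fintype.card X := by
  classical
  let P : ℕ → X → Prop := fun n s => ∃ u v, sacc δ fin s u v ∧ u.length = n
  have key : ∀ n s, P n s → (∀ m < n, ¬ P m s) →
      ∀ j ≤ n, ∃ t, P j t ∧ ∀ m < j, ¬ P m t := by
    intro n
    induction n with
    | zero =>
      intro s hs hm j hj
      obtain rfl : j = 0 := by omega
      exact ⟨s, hs, hm⟩
    | succ n ih =>
      intro s hs hm j hj
      rcases Nat.lt_or_ge n j with h | h
      · obtain rfl : j = n + 1 := by omega
        exact ⟨s, hs, hm⟩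
      · obtain ⟨u, v, h1, h2⟩ := hs
        match u, v, h1, h2 with
        | x :: u, y :: v, ⟨t, ht, h1⟩, h2 =>
          refine ih t ⟨u, v, h1, by simpa using h2⟩ ?_ j h
          rintro m hmn ⟨u', v', h3, h4⟩
          exact hm (m + 1) (by omega) ⟨x :: u', y :: v', ⟨t, ht, h3⟩, by simp [h4]⟩
  have hex : ∃ n, P n s := ⟨_, u, v, h, rfl⟩
  obtain ⟨u', v', h1, h2⟩ := Nat.find_spec hex
  refine ⟨u', v', h1, ?_⟩
  rw [h2]
  have hk := key _ s (Nat.find_spec hex) (fun m hm => Nat.find_min hex hm)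
  choose f hf using fun j : Fin (Nat.find hex + 1) => hk j (by omega)
  have hinj : Function.Injective f := by
    intro i j hij
    by_contra hne
    rcases lt_or_gt_of_ne hne with hlt | hlt
    · exact (hf j).2 i hlt (hij ▸ (hf i).1)
    · exact (hf i).2 j hlt (hij ▸ (hf j).1)
  have := Fintype.card_le_of_injective f hinj
  simpa using this

section graph

variable {A Γ : Type} (G : RationalGraph A Γ)

/-- Common state space of all the transducers of `G`, plus the identity. -/
abbrev SS : Type := Option (Σ a, (G.trans a).Q)

/-- Transitions. -/
def sδ : SS G → Γ → Γ → SS G → Prop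
  | none, x, y, t => x = y ∧ t = none
  | some ⟨a, q⟩, x, y, t => ∃ q', (G.trans a).trans q (some x, some y) q' ∧ t = some ⟨a, q'⟩

/-- Final states. -/
def sfin : SS G → Prop
  | none => True
  | some ⟨a, q⟩ => q ∈ (G.trans a).final

/-- Initial states. -/
def sinit : Option A → SS G
  | none => none
  | some a => some ⟨a, (G.trans a).init⟩

/-- The relation recognized from a state. -/
abbrev acc : SS G → List Γ → List Γ → Prop := sacc (sδ G) (sfin G)

theorem acc_none (u v : List Γ) : acc G none u v ↔ u = v := by
  induction u generalizing v with
  | nil => cases v <;> simp [sacc, sfin]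
  | cons x u ih =>
    cases v with
    | nil => simp [sacc]
    | cons y v =>
      simp only [List.cons.injEq, sacc, sδ]
      constructor
      · rintro ⟨t, ⟨rfl, rfl⟩, h⟩; exact ⟨rfl, (ih v).1 h⟩
      · rintro ⟨rfl, h⟩; exact ⟨none, ⟨rfl, rfl⟩, (ih v).2 h⟩

theorem acc_some (hG : G.Synchronous) (a : A) (q : (G.trans a).Q) (u v : List Γ) :
    acc G (some ⟨a, q⟩) u v ↔ ∃ q' ls, (G.trans a).Path q ls q' ∧ q' ∈ (G.trans a).final ∧
      Transducer.ins ls = u ∧ Transducer.outs ls = v := by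
  constructor
  · intro h
    induction u generalizing q v with
    | nil =>
      cases v with
      | nil => exact ⟨q, [], .nil q, h, rfl, rfl⟩
      | cons => exact h.elim
    | cons x u ih =>
      cases v with
      | nil => exact h.elim
      | cons y v =>
        obtain ⟨t, ⟨q', ht, rfl⟩, h⟩ := h
        obtain ⟨q'', ls, h1, h2, h3, h4⟩ := ih q' v h
        exact ⟨q'', (some x, some y) :: ls, .cons ht h1, h2, by
          simp [Transducer.ins] at h3 ⊢; exact h3, by simp [Transducer.outs] at h4 ⊢; exact h4⟩
  · rintro ⟨q', ls, hp, hf, h1, h2⟩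
    induction hp generalizing u v with
    | nil q =>
      simp [Transducer.ins, Transducer.outs] at h1 h2
      subst h1; subst h2
      exact hf
    | @cons q q' q'' l ls ht hp ih =>
      obtain ⟨hx, hy⟩ := hG a _ _ _ ht
      obtain ⟨l1, l2⟩ := l
      obtain ⟨x, rfl⟩ := Option.isSome_iff_exists.1 hx
      obtain ⟨y, rfl⟩ := Option.isSome_iff_exists.1 hy
      subst h1; subst h2
      exact ⟨some ⟨a, q'⟩, ⟨q', ht, rfl⟩, ih _ _ hf rfl rfl⟩

theorem acc_edge (hG : G.Synchronous) (a : A) (u v : List Γ) :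
    acc G (sinit G (some a)) u v ↔ G.Edge u a v :=
  acc_some G hG a _ u v

theorem conn_length (hG : G.Synchronous) {w : List A} {u v : List Γ}
    (h : conn G.Edge w u v) : u.length = v.length := by
  induction w generalizing u with
  | nil => exact congrArg _ h
  | cons a w ih =>
    obtain ⟨m, h1, h2⟩ := h
    exact (sacc_length ((acc_edge G hG a u m).2 h1)).trans (ih h2)

theorem conn_sacc [Fintype (SS G)] (hG : G.Synchronous) (w : List A) :
    ∃ (X : Type) (_ : Fintype X) (δ : X → Γ → Γ → X → Prop) (fin : X → Prop) (x0 : X),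
      Fintype.card X = Fintype.card (SS G) ^ w.length ∧
      ∀ u v, sacc δ fin x0 u v ↔ conn G.Edge w u v := by
  induction w with
  | nil =>
    refine ⟨Unit, inferInstance, fun _ x y _ => x = y, fun _ => True, (), by simp, ?_⟩
    intro u v
    induction u generalizing v with
    | nil => cases v <;> simp [sacc, conn]
    | cons x u ih =>
      cases v with
      | nil => simp [sacc, conn]
      | cons y v => 
        have := ih v
        simp only [conn] at this
        simp [sacc, conn, this]
  | cons a w ih =>
    obtain ⟨X, _, δ, fin, x0, hc, hX⟩ := ih
    refine ⟨SS G × X, inferInstance, _, _, (sinit G (some a), x0), ?_, fun u v =>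
      (sacc_comp (sδ G) (sfin G) δ fin (sinit G (some a)) x0 u v).trans ?_⟩
    · simp [hc, pow_succ, mul_comm]
    · simp only [conn]
      exact exists_congr fun m => and_congr (acc_edge G hG a u m) (hX m v)

/-- Identity restricted to a regular language. -/
theorem dfa_sacc {Q : Type} (M : DFA Γ Q) (q : Q) (u v : List Γ) :
    sacc (fun q x y q' => x = y ∧ q' = M.step q x) (fun q => q ∈ M.accept) q u v ↔
      u = v ∧ M.evalFrom q u ∈ M.accept := by
  induction u generalizing q v with
  | nil => cases v <;> simp [sacc]
  | cons x u ih =>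
    cases v with
    | nil => simp [sacc]
    | cons y v =>
      simp only [sacc, List.cons.injEq, DFA.evalFrom_cons]
      constructor
      · rintro ⟨t, ⟨rfl, rfl⟩, h⟩
        have := (ih _ _).1 h
        exact ⟨⟨rfl, this.1⟩, this.2⟩
      · rintro ⟨⟨rfl, h⟩, h'⟩
        exact ⟨_, ⟨rfl, rfl⟩, (ih _ _).2 ⟨h, h'⟩⟩

theorem short_path [Fintype (SS G)] (hG : G.Synchronous) {Q Q' : Type} [Fintype Q] [Fintype Q']
    (M : DFA Γ Q) (M' : DFA Γ Q') (w : List A) (u v : List Γ)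
    (hu : u ∈ M.accepts) (hv : v ∈ M'.accepts) (h : conn G.Edge w u v) :
    ∃ u ∈ M.accepts, ∃ v ∈ M'.accepts, conn G.Edge w u v ∧
      u.length < Fintype.card Q * Fintype.card Q' * Fintype.card (SS G) ^ w.length := by
  obtain ⟨X, _, δ, fin, x0, hc, hX⟩ := conn_sacc G hG w
  have hiff := fun u v => (sacc_comp _ _ (fun q x y q' => x = y ∧ q' = M'.step q x)
      (fun q => q ∈ M'.accept) (M.start, x0) M'.start u v).trans
      (exists_congr fun m => and_congr_left' (sacc_comp (fun q x y q' => x = y ∧ q' = M.step q x)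
        (fun q => q ∈ M.accept) δ fin M.start x0 u m))
  obtain ⟨u', v', h1, h2⟩ := sacc_shorten _ _ ((M.start, x0), M'.start) u v
    ((hiff u v).2 ⟨v, ⟨u, (dfa_sacc M _ u u).2 ⟨rfl, hu⟩, (hX u v).2 h⟩,
        (dfa_sacc M' _ v v).2 ⟨rfl, hv⟩⟩)
  obtain ⟨v'', ⟨u'', h5, h6⟩, h4⟩ := (hiff u' v').1 h1
  obtain ⟨rfl, h5'⟩ := (dfa_sacc M _ _ _).1 h5
  obtain ⟨rfl, h4'⟩ := (dfa_sacc M' _ _ _).1 h4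
  refine ⟨u', h5', v'', h4', (hX _ _).1 h6, ?_⟩
  refine h2.trans_eq ?_
  simp [hc]
  ring

end graph

/-- Vertex alphabet of `H`. -/
inductive Al (A Γ : Type) where
  | st (a : A)
  | hs (h : Bool)
  | mk
  | pr (p : Γ × Γ)
  | em (x : Γ)

/-- States of the transducers of `H`. -/
inductive St (A S Q : Type) (C : ℕ) where
  | start
  | copyG
  | grow (j : Fin (C + 1))
  | copyS (o : Option A)
  | step (s t : S)
  | fin (r : Q) (t : S)

theorem al_finite {A Γ : Type} [Finite A] [Finite Γ] : Finite (Al A Γ) := by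
  let f : Al A Γ → A ⊕ Bool ⊕ Unit ⊕ (Γ × Γ) ⊕ Γ := fun
    | .st a => .inl a
    | .hs h => .inr (.inl h)
    | .mk => .inr (.inr (.inl ()))
    | .pr p => .inr (.inr (.inr (.inl p)))
    | .em x => .inr (.inr (.inr (.inr x)))
  refine Finite.of_injective f ?_
  intro x y h
  cases x <;> cases y <;> simp_all [f]

theorem st_finite {A S Q : Type} {C : ℕ} [Finite A] [Finite S] [Finite Q] :
    Finite (St A S Q C) := by
  let f : St A S Q C → Unit ⊕ Unit ⊕ Fin (C + 1) ⊕ Option A ⊕ (S × S) ⊕ (Q × S) := fun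
    | .start => .inl ()
    | .copyG => .inr (.inl ())
    | .grow j => .inr (.inr (.inl j))
    | .copyS o => .inr (.inr (.inr (.inl o)))
    | .step s t => .inr (.inr (.inr (.inr (.inl (s, t)))))
    | .fin r t => .inr (.inr (.inr (.inr (.inr (r, t)))))
  refine Finite.of_injective f ?_
  intro x y h
  cases x <;> cases y <;> simp_all [f]

/-- A row letter read as a pair of letters. -/
inductive RL {A Γ : Type} : Al A Γ → Γ × Γ → Prop
  | mk (x : Γ) : RL .mk (x, x)
  | pr (p : Γ × Γ) : RL (.pr p) p

/-- A row read as a list of pairs. -/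
inductive Reads {A Γ : Type} : List (Al A Γ) → List (Γ × Γ) → Prop
  | nil : Reads [] []
  | drop {row ps} : Reads row ps → Reads (.mk :: row) ps
  | cons {l p row ps} : RL l p → Reads row ps → Reads (l :: row) (p :: ps)

/-- Vertices of `H`. -/
def V {A Γ : Type} (h : Bool) (s : List A) (row : List (Al A Γ)) : List (Al A Γ) :=
  s.map .st ++ .hs h :: row

section constr

variable {A Γ : Type} (G : RationalGraph A Γ) {Q : Type} (M : DFA Γ Q) (C : ℕ)

/-- Transitions of the transducers of `H`. -/
inductive Tr (b : A) : St A (SS G) Q C → Option (Al A Γ) × Option (Al A Γ) →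
    St A (SS G) Q C → Prop
  | push : Tr b .start (none, some (.st b)) .copyG
  | copyG (c : A) : Tr b .copyG (some (.st c), some (.st c)) .copyG
  | hashG : Tr b .copyG (some (.hs true), some (.hs true)) (.grow 0)
  | growRead : Tr b (.grow 0) (some .mk, none) (.grow (Fin.last C))
  | growEmit (j : Fin C) : Tr b (.grow j.succ) (none, some .mk) (.grow j.castSucc)
  | pop (o : Option A) : Tr b .start (o.map .st, none) (.copyS o)
  | copyS (o : Option A) (c : A) : Tr b (.copyS o) (some (.st c), some (.st c)) (.copyS o)
  | hashS (o : Option A) (h : Bool) :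
      Tr b (.copyS o) (some (.hs h), some (.hs false)) (.step (sinit G o) (sinit G (some b)))
  | stepDrop (s t : SS G) : Tr b (.step s t) (some .mk, none) (.step s t)
  | stepRow (s t s' t' : SS G) (l : Al A Γ) (p p' : Γ × Γ) : RL l p →
      sδ G s p'.1 p.1 s' → sδ G t p.2 p'.2 t' →
      Tr b (.step s t) (some l, some (.pr p')) (.step s' t')
  | hashF (h : Bool) : Tr b .start (some (.hs h), none) (.fin M.start (sinit G (some b)))
  | finDrop (r : Q) (t : SS G) : Tr b (.fin r t) (some .mk, none) (.fin r t)
  | finRow (r : Q) (t t' : SS G) (l : Al A Γ) (p : Γ × Γ) (y : Γ) : RL l p →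
      sδ G t p.2 y t' → Tr b (.fin r t) (some l, some (.em y)) (.fin (M.step r p.1) t')

/-- Final states. -/
def tfin : St A (SS G) Q C → Prop
  | .grow j => j = 0
  | .step s t => sfin G s ∧ sfin G t
  | .fin r t => r ∈ M.accept ∧ sfin G t
  | _ => False

/-- The graph `H`. -/
def H [Fintype (St A (SS G) Q C)] : RationalGraph A (Al A Γ) where
  trans b :=
    { Q := St A (SS G) Q C
      fintypeQ := inferInstance
      init := .start
      final := {q | tfin G M C q}
      trans := Tr G M C b }

/-- Specification of the edges of `H`. -/
inductive ES (b : A) : List (Al A Γ) → List (Al A Γ) → Prop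
  | push (s : List A) (m : ℕ) :
      ES b (V true s (List.replicate m .mk)) (V true (b :: s) (List.replicate (C * m) .mk))
  | step (o : Option A) (h : Bool) (s : List A) (row : List (Al A Γ)) (ps ps' : List (Γ × Γ)) :
      Reads row ps → acc G (sinit G o) (ps'.map Prod.fst) (ps.map Prod.fst) →
      acc G (sinit G (some b)) (ps.map Prod.snd) (ps'.map Prod.snd) →
      ES b (V h (o.toList ++ s) row) (V false s (ps'.map .pr))
  | fin (h : Bool) (row : List (Al A Γ)) (ps : List (Γ × Γ)) (q : List Γ) :
      Reads row ps → ps.map Prod.fst ∈ M.accepts →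
      acc G (sinit G (some b)) (ps.map Prod.snd) q →
      ES b (V h [] row) (q.map .em)

/-- Specification of the states. -/
def Spec (b : A) : St A (SS G) Q C → List (Al A Γ) → List (Al A Γ) → Prop
  | .start, u, v => ES G M C b u v
  | .copyG, u, v => ∃ s m, u = V true s (List.replicate m .mk) ∧
      v = V true s (List.replicate (C * m) .mk)
  | .grow j, u, v => ∃ m, u = List.replicate m .mk ∧ v = List.replicate (j.val + C * m) .mk
  | .copyS o, u, v => ∃ (h : Bool) (s : List A) (row : List (Al A Γ)) (ps ps' : List (Γ × Γ)), u = V h s row ∧ v = V false s (ps'.map .pr) ∧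
      Reads row ps ∧ acc G (sinit G o) (ps'.map Prod.fst) (ps.map Prod.fst) ∧
      acc G (sinit G (some b)) (ps.map Prod.snd) (ps'.map Prod.snd)
  | .step s t, u, v => ∃ ps ps' : List (Γ × Γ), v = ps'.map .pr ∧
      Reads u ps ∧ acc G s (ps'.map Prod.fst) (ps.map Prod.fst) ∧
      acc G t (ps.map Prod.snd) (ps'.map Prod.snd)
  | .fin r t, u, v => ∃ (ps : List (Γ × Γ)) (q : List Γ), v = q.map .em ∧
      Reads u ps ∧ M.evalFrom r (ps.map Prod.fst) ∈ M.accept ∧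
      acc G t (ps.map Prod.snd) q

/-- Acceptance from a state. -/
inductive TA (b : A) : St A (SS G) Q C → List (Al A Γ) → List (Al A Γ) → Prop
  | nil {q} : tfin G M C q → TA b q [] []
  | cons {q q' x y u v} : Tr G M C b q (x, y) q' → TA b q' u v →
      TA b q (x.toList ++ u) (y.toList ++ v)

theorem edge_TA [Fintype (St A (SS G) Q C)] (b : A) (u v : List (Al A Γ)) :
    (H G M C).Edge u b v ↔ TA G M C b .start u v := by
  constructor
  · rintro ⟨q, ls, hp, hf, rfl, rfl⟩
    suffices ∀ (q0 q : ((H G M C).trans b).Q) (ls : _), ((H G M C).trans b).Path q0 ls q →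
        q ∈ ((H G M C).trans b).final →
        TA G M C b q0 (Transducer.ins ls) (Transducer.outs ls) from this _ _ _ hp hf
    clear hp hf
    intro q0 q ls hp hf
    induction hp with
    | nil q => exact .nil hf
    | @cons q q' q'' l ls ht hp ih =>
      obtain ⟨x, y⟩ := l
      exact .cons ht (ih hf)
  · intro h
    suffices ∀ q0, TA G M C b q0 u v → ∃ (q : ((H G M C).trans b).Q) (ls : _),
        ((H G M C).trans b).Path q0 ls q ∧ q ∈ ((H G M C).trans b).final ∧
        Transducer.ins ls = u ∧ Transducer.outs ls = v from this _ h
    clear h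
    intro q0 h
    induction h with
    | @nil q h =>
      exact ⟨q, [], Transducer.Path.nil (T := (H G M C).trans b) q, h, rfl, rfl⟩
    | @cons q q' x y u v ht h ih =>
      obtain ⟨q'', ls, h1, h2, rfl, rfl⟩ := ih
      exact ⟨q'', (x, y) :: ls, Transducer.Path.cons (T := (H G M C).trans b) ht h1, h2, rfl, rfl⟩

theorem TA_spec (b : A) (q : St A (SS G) Q C) (u v : List (Al A Γ))
    (h : TA G M C b q u v) : Spec G M C b q u v := by
  induction h with
  | @nil q h =>
    cases q with
    | start => exact h.elim
    | copyG => exact h.elim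
    | copyS => exact h.elim
    | grow j =>
      obtain rfl : j = 0 := h
      exact ⟨0, rfl, by simp⟩
    | step s t => exact ⟨[], [], rfl, .nil, h.1, h.2⟩
    | fin r t => exact ⟨[], [], rfl, .nil, h.1, h.2⟩
  | @cons q q' x y u v ht h ih =>
    clear h
    cases ht with
    | push =>
      obtain ⟨s, m, rfl, rfl⟩ := ih
      exact .push s m
    | copyG c =>
      obtain ⟨s, m, rfl, rfl⟩ := ih
      exact ⟨c :: s, m, rfl, rfl⟩
    | hashG =>
      obtain ⟨m, rfl, rfl⟩ := ih
      exact ⟨[], m, rfl, by simp [V]⟩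
    | growRead =>
      obtain ⟨m, rfl, rfl⟩ := ih
      exact ⟨m + 1, rfl, by simp [mul_add, add_comm]⟩
    | growEmit j =>
      obtain ⟨m, rfl, rfl⟩ := ih
      refine ⟨m, rfl, ?_⟩
      have : (j.succ.val + C * m) = (j.castSucc.val + C * m) + 1 := by simp; omega
      rw [this, List.replicate_succ]; rfl
    | pop o =>
      obtain ⟨h, s, row, ps, ps', rfl, rfl, h1, h2, h3⟩ := ih
      have := ES.step (G := G) (M := M) (C := C) o h s row ps ps' h1 h2 h3
      cases o <;> exact this
    | copyS o c =>
      obtain ⟨h, s, row, ps, ps', rfl, rfl, h1, h2, h3⟩ := ih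
      exact ⟨h, c :: s, row, ps, ps', rfl, rfl, h1, h2, h3⟩
    | hashS o h =>
      obtain ⟨ps, ps', rfl, h1, h2, h3⟩ := ih
      exact ⟨h, [], u, ps, ps', rfl, rfl, h1, h2, h3⟩
    | stepDrop s t =>
      obtain ⟨ps, ps', rfl, h1, h2, h3⟩ := ih
      exact ⟨ps, ps', rfl, .drop h1, h2, h3⟩
    | stepRow s t s' t' l p p' hl d1 d2 =>
      obtain ⟨ps, ps', rfl, h1, h2, h3⟩ := ih
      exact ⟨p :: ps, p' :: ps', rfl, .cons hl h1, ⟨s', d1, h2⟩, ⟨t', d2, h3⟩⟩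
    | hashF h =>
      obtain ⟨ps, q, rfl, h1, h2, h3⟩ := ih
      exact .fin h u ps q h1 h2 h3
    | finDrop r t =>
      obtain ⟨ps, q, rfl, h1, h2, h3⟩ := ih
      exact ⟨ps, q, rfl, .drop h1, h2, h3⟩
    | finRow r t t' l p y hl d =>
      obtain ⟨ps, q, rfl, h1, h2, h3⟩ := ih
      exact ⟨p :: ps, y :: q, rfl, .cons hl h1, h2, ⟨t', d, h3⟩⟩

theorem TA_emit (b : A) (u : List (Al A Γ)) (k : ℕ) (v : List (Al A Γ))
    (h : TA G M C b (.grow 0) u v) (hk : k < C + 1) :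
    TA G M C b (.grow ⟨k, hk⟩) u (List.replicate k .mk ++ v) := by
  induction k with
  | zero => exact h
  | succ k ih => exact .cons (.growEmit ⟨k, by omega⟩) (ih (by omega))

theorem TA_grow (b : A) (m : ℕ) :
    TA G M C b (.grow 0) (List.replicate m .mk) (List.replicate (C * m) .mk) := by
  induction m with
  | zero => exact .nil rfl
  | succ m ih =>
    have := TA.cons (.growRead) (TA_emit G M C b _ C _ ih (by omega))
    have e : C * (m + 1) = C + C * m := by ring
    rw [e, List.replicate_add C (C * m)]
    exact this

theorem TA_step (b : A) (row : List (Al A Γ)) (ps : List (Γ × Γ)) (hr : Reads row ps)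
    (s t : SS G) (ps' : List (Γ × Γ)) (h1 : acc G s (ps'.map Prod.fst) (ps.map Prod.fst))
    (h2 : acc G t (ps.map Prod.snd) (ps'.map Prod.snd)) :
    TA G M C b (.step s t) row (ps'.map .pr) := by
  induction hr generalizing s t ps' with
  | nil =>
    cases ps' with
    | nil => exact .nil ⟨h1, h2⟩
    | cons => exact h1.elim
  | drop hr ih => exact .cons (.stepDrop s t) (ih s t ps' h1 h2)
  | cons hl hr ih =>
    cases ps' with
    | nil => exact h1.elim
    | cons p' ps' =>
      obtain ⟨s', d1, h1⟩ := h1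
      obtain ⟨t', d2, h2⟩ := h2
      exact .cons (.stepRow s t s' t' _ _ p' hl d1 d2) (ih s' t' ps' h1 h2)

theorem TA_fin (b : A) (row : List (Al A Γ)) (ps : List (Γ × Γ)) (hr : Reads row ps)
    (r : Q) (t : SS G) (q : List Γ) (h1 : M.evalFrom r (ps.map Prod.fst) ∈ M.accept)
    (h2 : acc G t (ps.map Prod.snd) q) :
    TA G M C b (.fin r t) row (q.map .em) := by
  induction hr generalizing r t q with
  | nil =>
    cases q with
    | nil => exact .nil ⟨h1, h2⟩
    | cons => exact h2.elim
  | drop hr ih => exact .cons (.finDrop r t) (ih r t q h1 h2)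
  | cons hl hr ih =>
    cases q with
    | nil => exact h2.elim
    | cons y q =>
      obtain ⟨t', d2, h2⟩ := h2
      exact .cons (.finRow r t t' _ _ y hl d2) (ih _ t' q h1 h2)

theorem ES_TA (b : A) (u v : List (Al A Γ)) (h : ES G M C b u v) :
    TA G M C b .start u v := by
  cases h with
  | push s m =>
    refine TA.cons (x := none) (.push) ?_
    induction s with
    | nil => exact .cons .hashG (TA_grow G M C b m)
    | cons c s ih => exact .cons (.copyG c) ih
  | step o h s row ps ps' h1 h2 h3 =>
    have : TA G M C b (.copyS o) (V h s row) (V false s (ps'.map .pr)) := by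
      induction s with
      | nil => exact .cons (.hashS o h) (TA_step G M C b row ps h1 _ _ ps' h2 h3)
      | cons c s ih => exact .cons (.copyS o c) ih
    have := TA.cons (.pop o) this
    cases o <;> exact this
  | fin h row ps q h1 h2 h3 =>
    exact .cons (.hashF h) (TA_fin G M C b row ps h1 _ _ q h2 h3)

theorem edge_iff [Fintype (St A (SS G) Q C)] (b : A) (u v : List (Al A Γ)) :
    (H G M C).Edge u b v ↔ ES G M C b u v :=
  (edge_TA G M C b u v).trans ⟨TA_spec G M C b _ u v, ES_TA G M C b u v⟩

end constr

theorem reads_length {A Γ : Type} {row : List (Al A Γ)} {ps : List (Γ × Γ)}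
    (h : Reads row ps) : ps.length ≤ row.length := by
  induction h with
  | nil => simp
  | drop _ ih => simp; omega
  | cons _ _ ih => simpa using ih

theorem reads_pr {A Γ : Type} {ps ps' : List (Γ × Γ)}
    (h : Reads (ps.map (Al.pr (A := A))) ps') : ps' = ps := by
  induction ps generalizing ps' with
  | nil => cases h; rfl
  | cons p ps ih =>
    cases h with
    | cons hl h => cases hl; rw [ih h]

theorem reads_pr_self {A Γ : Type} (ps : List (Γ × Γ)) :
    Reads (ps.map (Al.pr (A := A))) ps := by
  induction ps with
  | nil => exact .nil
  | cons p ps ih => exact .cons (.pr p) ih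

theorem reads_mk {A Γ : Type} {m : ℕ} {ps : List (Γ × Γ)}
    (h : Reads (List.replicate m (Al.mk (A := A))) ps) : ps.map Prod.fst = ps.map Prod.snd := by
  induction m generalizing ps with
  | zero => cases h; rfl
  | succ m ih =>
    cases h with
    | drop h => exact ih h
    | cons hl h => cases hl; simp [ih h]

theorem reads_mk_diag {A Γ : Type} {m : ℕ} {u : List Γ} (h : u.length ≤ m) :
    Reads (List.replicate m (Al.mk (A := A))) (u.map fun x => (x, x)) := by
  induction m generalizing u with
  | zero => 
    obtain rfl : u = [] := by simpa using h
    exact .nil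
  | succ m ih =>
    cases u with
    | nil => exact .drop (ih (u := []) (by simp))
    | cons x u => exact .cons (.mk x) (ih (by simpa using h))

theorem V_inj {A Γ : Type} {h h' : Bool} {s s' : List A} {row row' : List (Al A Γ)}
    (e : V h s row = V h' s' row') : h = h' ∧ s = s' ∧ row = row' := by
  induction s generalizing s' with
  | nil => cases s' <;> simp_all [V]
  | cons a s ih =>
    cases s' with
    | nil => simp [V] at e
    | cons b s' =>
      simp only [V, List.map_cons, List.cons_append, List.cons.injEq, Al.st.injEq] at e
      obtain ⟨h1, h2, h3⟩ := ih e.2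
      exact ⟨h1, by rw [e.1, h2], h3⟩

theorem V_ne {A Γ : Type} {h : Bool} {s : List A} {row : List (Al A Γ)} {q : List Γ}
    (e : V h s row = q.map .em) : False := by
  have : Al.hs h ∈ V h s row := by simp [V]
  rw [e] at this
  simp at this

section main

variable {A Γ : Type} (G : RationalGraph A Γ) {Q : Type} (M : DFA Γ Q) (C : ℕ)

theorem ES_length (b : A) {u v : List (Al A Γ)} (h : ES G M C b u v) :
    v.length ≤ (C + 2) * u.length := by
  cases h with
  | push s m => simp [V]; nlinarith
  | step o h s row ps ps' h1 h2 h3 =>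
    have a1 := reads_length h1
    have a2 := sacc_length h2
    simp [V] at a2 ⊢
    nlinarith
  | fin h row ps q h1 h2 h3 =>
    have a1 := reads_length h1
    have a2 := sacc_length h3
    simp [V] at a2 ⊢
    nlinarith

theorem H_finite [Finite A] [Finite Γ] [Fintype (St A (SS G) Q C)] :
    (H G M C).FiniteOutDegree := by
  intro u
  have : Finite (Al A Γ) := al_finite
  refine (Set.Finite.prod (Set.finite_univ (α := A))
    (List.finite_length_le (Al A Γ) ((C + 2) * u.length))).subset ?_
  rintro ⟨b, v⟩ h
  exact ⟨trivial, ES_length G M C b ((edge_iff G M C b u v).1 h)⟩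

theorem ES_inv (b : A) {h : Bool} {s : List A} {row Y : List (Al A Γ)}
    (e : ES G M C b (V h s row) Y) :
    (h = true ∧ ∃ m, row = List.replicate m .mk ∧
      Y = V true (b :: s) (List.replicate (C * m) .mk)) ∨
    (∃ (o : Option A) (s' : List A) (ps ps' : List (Γ × Γ)), s = o.toList ++ s' ∧ Reads row ps ∧
      acc G (sinit G o) (ps'.map Prod.fst) (ps.map Prod.fst) ∧
      acc G (sinit G (some b)) (ps.map Prod.snd) (ps'.map Prod.snd) ∧
      Y = V false s' (ps'.map .pr)) ∨
    (∃ (ps : List (Γ × Γ)) (q : List Γ), s = [] ∧ Reads row ps ∧ ps.map Prod.fst ∈ M.accepts ∧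
      acc G (sinit G (some b)) (ps.map Prod.snd) q ∧ Y = q.map .em) := by
  generalize hX : V h s row = X at e
  cases e with
  | push s m =>
    obtain ⟨rfl, rfl, rfl⟩ := V_inj hX
    exact .inl ⟨rfl, m, rfl, rfl⟩
  | step o h s row ps ps' h1 h2 h3 =>
    obtain ⟨rfl, rfl, rfl⟩ := V_inj hX
    exact .inr (.inl ⟨o, s, ps, ps', rfl, h1, h2, h3, rfl⟩)
  | fin h row ps q h1 h2 h3 =>
    obtain ⟨rfl, rfl, rfl⟩ := V_inj hX
    exact .inr (.inr ⟨ps, q, rfl, h1, h2, h3, rfl⟩)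

theorem ES_em (b : A) {q : List Γ} {Y : List (Al A Γ)}
    (e : ES G M C b (q.map .em) Y) : False := by
  generalize hX : q.map (Al.em (A := A)) = X at e
  cases e <;> exact V_ne hX.symm

theorem conn_opt (hG : G.Synchronous) (o : Option A) (u v : List Γ) :
    acc G (sinit G o) u v ↔ conn G.Edge o.toList u v := by
  cases o with
  | none => exact acc_none G u v
  | some a =>
    rw [acc_edge G hG]
    simp [conn]

theorem em_inj {q f : List Γ} (h : q.map (Al.em (A := A)) = f.map .em) : q = f :=
  List.map_injective_iff.2 (fun x y h => by cases h; rfl) h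

theorem sound [Fintype (St A (SS G) Q C)] (hG : G.Synchronous) (w : List A) (h : Bool)
    (s : List A) (row : List (Al A Γ)) (f : List Γ)
    (hc : conn (H G M C).Edge w (V h s row) (f.map .em)) :
    (∃ ps, Reads row ps ∧ ∃ p0 ∈ M.accepts, conn G.Edge s.reverse p0 (ps.map Prod.fst) ∧
      conn G.Edge w (ps.map Prod.snd) f) ∨
    (h = true ∧ ∃ p0 ∈ M.accepts, conn G.Edge (s.reverse ++ w) p0 f) := by
  induction w generalizing h s row with
  | nil => exact (V_ne hc).elim
  | cons b w ih =>
    obtain ⟨Y, he, hc⟩ := hc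
    rcases ES_inv G M C b ((edge_iff G M C b _ _).1 he) with
      ⟨rfl, m, rfl, rfl⟩ | ⟨o, s', ps, ps', rfl, h1, h2, h3, rfl⟩ | ⟨ps, q, rfl, h1, h2, h3, rfl⟩
    · refine .inr ⟨rfl, ?_⟩
      rcases ih _ _ _ hc with ⟨ps, h1, p0, hp0, h2, h3⟩ | ⟨-, p0, hp0, h2⟩
      · refine ⟨p0, hp0, ?_⟩
        rw [← reads_mk h1] at h3
        have := (conn_append _ _ _ _ _).2 ⟨_, h2, h3⟩
        simpa using this
      · exact ⟨p0, hp0, by simpa using h2⟩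
    · rcases ih _ _ _ hc with ⟨ps'', h4, p0, hp0, h5, h6⟩ | ⟨h, -⟩
      · obtain rfl := reads_pr h4
        refine .inl ⟨ps, h1, p0, hp0, ?_, _, (acc_edge G hG b _ _).1 h3, h6⟩
        have e : (o.toList ++ s').reverse = s'.reverse ++ o.toList := by cases o <;> simp
        rw [e]
        exact (conn_append _ _ _ _ _).2 ⟨_, h5, (conn_opt G hG o _ _).1 h2⟩
      · cases h
    · cases w with
      | nil =>
        obtain rfl := em_inj hc
        exact .inl ⟨ps, h1, _, h2, rfl, _, (acc_edge G hG b _ _).1 h3, rfl⟩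
      | cons c w =>
        obtain ⟨Y, he, -⟩ := hc
        exact (ES_em G M C c ((edge_iff G M C c _ _).1 he)).elim

theorem pushes [Fintype (St A (SS G) Q C)] (x s : List A) (m : ℕ) :
    conn (H G M C).Edge x (V true s (List.replicate m .mk))
      (V true (x.reverse ++ s) (List.replicate (m * C ^ x.length) .mk)) := by
  induction x generalizing s m with
  | nil => simp [conn]
  | cons b x ih =>
    refine ⟨_, (edge_iff G M C b _ _).2 (.push s m), ?_⟩
    have := ih (b :: s) (C * m)
    have e : C * m * C ^ x.length = m * C ^ (b :: x).length := by
      simp [pow_succ]; ring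
    rw [e] at this
    simpa using this

theorem zip_fst {u v : List Γ} (h : u.length = v.length) : (u.zip v).map Prod.fst = u :=
  List.map_fst_zip h.le

theorem zip_snd {u v : List Γ} (h : u.length = v.length) : (u.zip v).map Prod.snd = v :=
  List.map_snd_zip h.ge

theorem one_step [Fintype (St A (SS G) Q C)] (hG : G.Synchronous) (b : A) (o : Option A)
    (s : List A) (h : Bool) (row : List (Al A Γ)) (ps : List (Γ × Γ)) (hr : Reads row ps)
    (p' q' : List Γ) (h1 : conn G.Edge o.toList p' (ps.map Prod.fst))
    (h2 : G.Edge (ps.map Prod.snd) b q') :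
    ∃ row' ps', (H G M C).Edge (V h (o.toList ++ s) row) b (V false s row') ∧
      Reads row' ps' ∧ ps'.map Prod.fst = p' ∧ ps'.map Prod.snd = q' := by
  have l1 := conn_length G hG h1
  have h2' := (acc_edge G hG b _ _).2 h2
  have l2 := sacc_length h2'
  have l : p'.length = q'.length := by simpa using l1.trans ((by simp)) |>.trans l2
  refine ⟨_, p'.zip q', (edge_iff G M C b _ _).2 (.step o h s row ps (p'.zip q') hr ?_ ?_),
    reads_pr_self _, zip_fst l, zip_snd l⟩
  · rw [zip_fst l]; exact (conn_opt G hG o _ _).2 h1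
  · rw [zip_snd l]; exact h2'

theorem steps [Fintype (St A (SS G) Q C)] (hG : G.Synchronous) (y s : List A) (h : Bool)
    (row : List (Al A Γ)) (ps : List (Γ × Γ)) (hr : Reads row ps) (hl : s.length = y.length)
    (p0 q' : List Γ) (h1 : conn G.Edge s.reverse p0 (ps.map Prod.fst))
    (h2 : conn G.Edge y (ps.map Prod.snd) q') :
    ∃ h' row' ps', conn (H G M C).Edge y (V h s row) (V h' [] row') ∧
      Reads row' ps' ∧ ps'.map Prod.fst = p0 ∧ ps'.map Prod.snd = q' := by
  induction y generalizing s h row ps with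
  | nil =>
    obtain rfl : s = [] := by simpa using hl
    exact ⟨h, row, ps, rfl, hr, Eq.symm h1, h2⟩
  | cons b y ih =>
    cases s with
    | nil => simp at hl
    | cons a s =>
      rw [List.reverse_cons, conn_append] at h1
      obtain ⟨p', h1, h1'⟩ := h1
      obtain ⟨q1, h2', h2⟩ := h2
      obtain ⟨row1, ps1, he, hr1, rfl, rfl⟩ :=
        one_step G M C hG b (some a) s h row ps hr p' q1 h1' h2'
      obtain ⟨h', row', ps', hc, h3⟩ := ih s false row1 ps1 hr1 (by simpa using hl) h1 h2
      exact ⟨h', row', ps', ⟨_, he, hc⟩, h3⟩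

theorem split (w : List A) (hw : w ≠ []) : ∃ (x : List A) (o : Option A) (y : List A) (c : A),
    w = x ++ (o.toList ++ (y ++ [c])) ∧ x.length = y.length := by
  obtain ⟨w', c, rfl⟩ : ∃ w' c, w = w' ++ [c] :=
    ⟨w.dropLast, w.getLast hw, (List.dropLast_append_getLast hw).symm⟩
  rcases Nat.even_or_odd' w'.length with ⟨k, hk | hk⟩
  · refine ⟨w'.take k, none, w'.drop k, c, ?_, ?_⟩
    · simp [← List.append_assoc]
    · simp; omega
  · refine ⟨w'.take k, some (w'[k]'(by omega)), w'.drop (k + 1), c, ?_, ?_⟩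
    · simp [← List.append_assoc]
    · simp; omega

theorem complete [Fintype (St A (SS G) Q C)] (hG : G.Synchronous) (x : List A) (o : Option A)
    (y : List A) (c : A) (hxy : x.length = y.length) (B : ℕ) (u f : List Γ)
    (hu : u ∈ M.accepts) (hl : u.length ≤ B * C ^ x.length)
    (h : conn G.Edge (x ++ (o.toList ++ (y ++ [c]))) u f) :
    conn (H G M C).Edge (x ++ (o.toList ++ (y ++ [c]))) (V true [] (List.replicate B .mk))
      (f.map .em) := by
  simp only [conn_append] at h
  obtain ⟨u1, h1, u2, h2, u3, h3, h4⟩ := h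
  have l1 := conn_length G hG h1
  refine (conn_append _ _ _ _ _).2 ⟨_, pushes G M C x [] B, ?_⟩
  rw [List.append_nil]
  have hr0 := reads_mk_diag (A := A) (u := u1) (m := B * C ^ x.length) (by omega)
  obtain ⟨h0, row, ps, hr, e1, e2, hc⟩ : ∃ h0 row ps, Reads row ps ∧ ps.map Prod.fst = u1 ∧
      ps.map Prod.snd = u2 ∧ conn (H G M C).Edge o.toList
        (V true x.reverse (List.replicate (B * C ^ x.length) .mk)) (V h0 x.reverse row) := by
    cases o with
    | none =>
      obtain rfl : u1 = u2 := h2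
      exact ⟨_, _, _, hr0, by simp [Function.comp_def], by simp [Function.comp_def], rfl⟩
    | some d =>
      obtain ⟨_, h2, rfl⟩ := h2
      obtain ⟨row1, ps1, he, hr1, e1, e2⟩ :=
        one_step G M C hG d none x.reverse true _ _ hr0 u1 _ (by simp [conn, Function.comp_def])
          (by simpa [Function.comp_def] using h2)
      exact ⟨false, row1, ps1, hr1, e1, e2, _, he, rfl⟩
  refine (conn_append _ _ _ _ _).2 ⟨_, hc, ?_⟩
  subst e2
  obtain ⟨h', row', ps', hc, hr', e1', e2⟩ := steps G M C hG y x.reverse h0 row ps hr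
    (by simpa using hxy) u u3 (by simpa [e1] using h1) h3
  refine (conn_append _ _ _ _ _).2 ⟨_, hc, ?_⟩
  subst e2
  obtain ⟨_, h4, rfl⟩ := h4
  exact ⟨_, (edge_iff G M C c _ _).2 (.fin h' row' ps' _ hr' (e1' ▸ hu) ((acc_edge G hG c _ _).2 h4)), rfl⟩

end main

end SyncFin

/-- For every synchronous rational graph `G` and rational sets `I`,
`F` with `I ∩ F = ∅`, there are a rational graph `H` of finite out-degree and a single
vertex `i` such that `L(G,I,F) = L(H,{i},F)` (where `F` is transported along an
injective embedding of the vertex alphabets). -/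
theorem synchronous_to_finite_degree_single_initial {A Γ : Type} [Fintype A] [Fintype Γ]
    (G : RationalGraph A Γ) (hG : G.Synchronous) (I F : Set (List Γ))
    (hI : Regular I) (hF : Regular F) (hIF : I ∩ F = ∅) :
    ∃ (Γ' : Type) (_ : Fintype Γ') (H : RationalGraph A Γ') (e : Γ → Γ')
      (i : List Γ'), Function.Injective e ∧ H.FiniteOutDegree ∧
        G.Lang I F = H.Lang {i} (List.map e '' F) := by
  obtain ⟨Q, _, M, rfl⟩ := hI
  obtain ⟨Q', _, M', rfl⟩ := hF
  have : ∀ a, Finite (G.trans a).Q := fun a => @Finite.of_fintype _ (G.trans a).fintypeQ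
  have : Fintype (SyncFin.SS G) := Fintype.ofFinite _
  let K := Fintype.card (SyncFin.SS G)
  let C := K ^ 2
  let B := Fintype.card Q * Fintype.card Q' * K ^ 2
  have : Finite (SyncFin.St A (SyncFin.SS G) Q C) := SyncFin.st_finite
  have : Fintype (SyncFin.St A (SyncFin.SS G) Q C) := Fintype.ofFinite _
  have : Finite (SyncFin.Al A Γ) := SyncFin.al_finite
  refine ⟨SyncFin.Al A Γ, Fintype.ofFinite _, SyncFin.H G M C, .em,
    SyncFin.V true [] (List.replicate B .mk), ?_, SyncFin.H_finite G M C, ?_⟩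
  · intro x y h
    cases h; rfl
  ext w
  refine (SyncFin.mem_lang _ _ _ _).trans (Iff.trans ?_ (SyncFin.mem_lang _ _ _ _).symm)
  constructor
  · rintro ⟨u, hu, f, hf, hc⟩
    have hw : w ≠ [] := by
      rintro rfl
      obtain rfl : u = f := hc
      have : u ∈ (∅ : Set (List Γ)) := hIF ▸ ⟨hu, hf⟩
      exact this
    obtain ⟨u, hu, f, hf, hc, hl⟩ := SyncFin.short_path G hG M M' w u f hu hf hc
    obtain ⟨x, o, y, c, rfl, hxy⟩ := SyncFin.split w hw
    refine ⟨_, rfl, _, ⟨f, hf, rfl⟩,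
      SyncFin.complete G M C hG x o y c hxy B u f hu (hl.le.trans ?_) hc⟩
    have hK : 0 < K := Fintype.card_pos
    have hn : (x ++ (o.toList ++ (y ++ [c]))).length ≤ 2 + 2 * x.length := by
      cases o <;> simp <;> omega
    calc _ ≤ Fintype.card Q * Fintype.card Q' * K ^ (2 + 2 * x.length) :=
          Nat.mul_le_mul_left _ (Nat.pow_le_pow_right hK hn)
      _ = B * C ^ x.length := by simp only [B, C]; ring
  · rintro ⟨_, rfl, _, ⟨f, hf, rfl⟩, hc⟩
    rcases SyncFin.sound G M C hG w true [] _ f hc with ⟨ps, h1, p0, hp0, h2, h3⟩ | ⟨-, p0, hp0, h2⟩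
    · rw [← SyncFin.reads_mk h1] at h3
      obtain rfl : p0 = _ := h2
      exact ⟨_, hp0, f, hf, h3⟩
    · exact ⟨p0, hp0, f, hf, h2⟩
end

section
/- A language L of nonempty words over a finite alphabet Σ is the path language L(H,{i},F) of some rational graph H of finite out-degree from a unique initial vertex i to a rational set F of final vertices if and only if L is the word language of some tiling system; that is, the path languages of rational graphs of finite out-degree from a unique initial vertex to a rational set of final vertices are exactly the languages recognized by tiling systems (equivalently, the context-sensitive languages). -/
/-! ### Functional reformulations -/

theorem RationalGraph.mem_lang_iff {A Γ : Type} (H : RationalGraph A Γ) (i : List Γ)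
    (F : Set (List Γ)) (w : List A) :
    w ∈ H.Lang {i} F ↔ ∃ vs : ℕ → List Γ, vs 0 = i ∧
      (∀ k a, w[k]? = some a → H.Edge (vs k) a (vs (k + 1))) ∧ vs w.length ∈ F := by
  constructor
  · rintro ⟨vs, i', f, ⟨hlen, hp⟩, hh, hi, hl, hf⟩
    refine ⟨fun k => vs.getD k [], ?_, ?_, ?_⟩
    · rw [Set.mem_singleton_iff] at hi
      subst hi
      cases vs with
      | nil => simp at hh
      | cons a l => simpa using hh
    · intro k a hk
      have hk' : k < w.length := by
        by_contra h
        rw [List.getElem?_eq_none (by omega)] at hk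
        simp at hk
      apply hp k a _ _ hk
      · rw [List.getElem?_eq_getElem (by omega)]
        simp [List.getD_eq_getElem?_getD, List.getElem?_eq_getElem (show k < vs.length by omega)]
      · rw [List.getElem?_eq_getElem (by omega)]
        simp [List.getD_eq_getElem?_getD,
          List.getElem?_eq_getElem (show k + 1 < vs.length by omega)]
    · rw [List.getLast?_eq_getElem?, hlen] at hl
      simp only [Nat.add_sub_cancel] at hl
      simp [List.getD_eq_getElem?_getD, hl, hf]
  · rintro ⟨vs, h0, hp, hf⟩
    refine ⟨List.ofFn (fun k : Fin (w.length + 1) => vs k), vs 0, vs w.length, ⟨by simp, ?_⟩,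
      ?_, h0, ?_, hf⟩
    · intro k a u v hk hu hv
      rw [List.getElem?_ofFn] at hu hv
      split_ifs at hu hv
      simp only [Option.some.injEq] at hu hv
      subst hu hv
      exact hp k a hk
    · simp [List.head?_eq_getElem?]
    · rw [List.getLast?_eq_getElem?, List.length_ofFn, List.getElem?_ofFn]
      simp

/-- Entry of a framed picture. -/
def pent {Λ : Type} (rows : List (List Λ)) (i j : ℕ) : Option Λ :=
  if i = 0 ∨ j = 0 then none else (rows[i - 1]?).bind fun r => r[j - 1]?

theorem framed_entry {Λ : Type} (rows : List (List Λ)) (m : ℕ)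
    (hr : ∀ r ∈ rows, r.length = m) (i j : ℕ) (hi : i ≤ rows.length + 1) (hj : j ≤ m + 1) :
    ∃ r, (framed rows m)[i]? = some r ∧ r[j]? = some (pent rows i j) := by
  rcases i with _ | i
  · refine ⟨_, rfl, ?_⟩
    simp [pent, List.getElem?_replicate]
    omega
  · simp only [framed, List.cons_append, List.getElem?_cons_succ]
    by_cases h : i < rows.length
    · rw [List.getElem?_append_left (by simpa using h)]
      refine ⟨none :: ((rows[i]).map some ++ [none]), by simp [h], ?_⟩
      have hl := hr _ (List.getElem_mem h)
      rcases j with _ | j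
      · simp [pent]
      · simp only [List.getElem?_cons_succ, pent]
        by_cases hjm : j < m
        · rw [List.getElem?_append_left (by simpa [hl] using hjm)]
          simp [h, hl, hjm]
        · have : j = m := by omega
          subst this
          rw [List.getElem?_append_right (by simp [hl])]
          simp [h, hl]
    · have : i = rows.length := by omega
      subst this
      rw [List.getElem?_append_right (by simp)]
      refine ⟨_, by simp; rfl, ?_⟩
      simp [pent, List.getElem?_replicate]
      omega

theorem framed_bound {Λ : Type} (rows : List (List Λ)) (m : ℕ)
    (hr : ∀ r ∈ rows, r.length = m) (i j : ℕ) (r : List (Option Λ)) (x : Option Λ)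
    (h : (framed rows m)[i]? = some r) (hx : r[j]? = some x) :
    i ≤ rows.length + 1 ∧ j ≤ m + 1 := by
  constructor
  · by_contra hc
    rw [List.getElem?_eq_none (by simp [framed]; omega)] at h
    simp at h
  · have hmem := List.mem_of_getElem? h
    have hlen : r.length = m + 2 := by
      simp only [framed, List.cons_append, List.mem_cons, List.mem_append, List.mem_map,
        List.not_mem_nil, or_false] at hmem
      rcases hmem with h | ⟨r', h1, h2⟩ | h
      · simp [h]
      · simp [← h2, hr r' h1]
      · simp [h]
    by_contra hc
    rw [List.getElem?_eq_none (by omega)] at hx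
    simp at hx

theorem tilesOf_framed {Λ : Type} (rows : List (List Λ)) (m : ℕ)
    (hr : ∀ r ∈ rows, r.length = m) (D : Set (Tile (Option Λ))) :
    tilesOf (framed rows m) ⊆ D ↔ ∀ i ≤ rows.length, ∀ j ≤ m,
      (⟨pent rows i j, pent rows i (j + 1), pent rows (i + 1) j, pent rows (i + 1) (j + 1)⟩ :
        Tile (Option Λ)) ∈ D := by
  constructor
  · intro h i hi j hj
    apply h
    obtain ⟨r1, a1, a2⟩ := framed_entry rows m hr i j (by omega) (by omega)
    obtain ⟨r1', b1, b2⟩ := framed_entry rows m hr i (j+1) (by omega) (by omega)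
    obtain ⟨r2, c1, c2⟩ := framed_entry rows m hr (i+1) j (by omega) (by omega)
    obtain ⟨r2', d1, d2⟩ := framed_entry rows m hr (i+1) (j+1) (by omega) (by omega)
    obtain rfl : r1 = r1' := by simpa [a1] using b1
    obtain rfl : r2 = r2' := by simpa [c1] using d1
    exact ⟨i, j, r1, r2, a1, c1, a2, b2, c2, d2⟩
  · rintro h ⟨tl, tr, bl, br⟩ ⟨i, j, r1, r2, h1, h2, h3, h4, h5, h6⟩
    simp only at h3 h4 h5 h6
    have hb := framed_bound rows m hr _ _ _ _ h2 h6
    obtain ⟨r1', a1, a2⟩ := framed_entry rows m hr i j (by omega) (by omega)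
    obtain ⟨r1'', b1, b2⟩ := framed_entry rows m hr i (j+1) (by omega) (by omega)
    obtain ⟨r2', c1, c2⟩ := framed_entry rows m hr (i+1) j (by omega) (by omega)
    obtain ⟨r2'', d1, d2⟩ := framed_entry rows m hr (i+1) (j+1) (by omega) (by omega)
    obtain rfl : r1 = r1' := by simpa [h1] using a1
    obtain rfl : r1 = r1'' := by simpa [h1] using b1
    obtain rfl : r2 = r2' := by simpa [h2] using c1
    obtain rfl : r2 = r2'' := by simpa [h2] using d1
    rw [h3] at a2; rw [h4] at b2; rw [h5] at c2; rw [h6] at d2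
    simp only [Option.some.injEq] at a2 b2 c2 d2
    subst a2 b2 c2 d2
    exact h i (by omega) j (by omega)

/-- Functional picture of size `(n, m)` accepted by `S`. -/
structure FPic {A Λ : Type} (S : TilingSystem A Λ) (w : List A) (n : ℕ)
    (p : ℕ → ℕ → Option Λ) : Prop where
  npos : 0 < n
  mpos : 0 < w.length
  shape : ∀ i j, p i j = none ↔ ¬ (1 ≤ i ∧ i ≤ n ∧ 1 ≤ j ∧ j ≤ w.length)
  tile : ∀ i ≤ n, ∀ j ≤ w.length,
    (⟨p i j, p i (j + 1), p (i + 1) j, p (i + 1) (j + 1)⟩ : Tile (Option Λ)) ∈ S.tiles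
  first : ∀ j a, w[j]? = some a → p 1 (j + 1) = some (S.emb a)

theorem TilingSystem.mem_lang_iff {A Λ : Type} (S : TilingSystem A Λ) (w : List A) :
    w ∈ S.Lang ↔ ∃ n p, FPic S w n p := by
  constructor
  · rintro ⟨rows, n, ⟨hn, hm, hlen, hr, ht⟩, hh⟩
    rw [tilesOf_framed rows _ hr] at ht
    subst hlen
    refine ⟨rows.length, pent rows, hn, hm, ?_, ht, ?_⟩
    · intro i j
      unfold pent
      split_ifs with h
      · simp; omega
      · by_cases hi : i - 1 < rows.length
        · have := hr _ (List.getElem_mem hi)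
          simp [hi, this]
          omega
        · simp [hi]
          omega
    · intro j a hj
      rw [List.head?_eq_getElem?] at hh
      simp [pent, hh, hj]
  · rintro ⟨n, p, hn, hm, hs, ht, hf⟩
    have hex : ∀ i j : ℕ, i < n → j < w.length → (p (i+1) (j+1)).isSome := by
      intro i j hi hj
      rw [Option.isSome_iff_ne_none, Ne, hs]
      omega
    let rows : List (List Λ) := List.ofFn fun i : Fin n => List.ofFn fun j : Fin w.length =>
      (p (i+1) (j+1)).get (hex i j i.2 j.2)
    have hrl : rows.length = n := by simp [rows]
    have hr : ∀ r ∈ rows, r.length = w.length := by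
      intro r hr
      simp only [rows, List.mem_ofFn] at hr
      obtain ⟨i, rfl⟩ := hr
      simp
    have hpe : ∀ i j, pent rows i j = p i j := by
      intro i j
      by_cases h : (1 ≤ i ∧ i ≤ n ∧ 1 ≤ j ∧ j ≤ w.length)
      · obtain ⟨i, rfl⟩ : ∃ i', i = i' + 1 := ⟨i - 1, by omega⟩
        obtain ⟨j, rfl⟩ : ∃ i', j = i' + 1 := ⟨j - 1, by omega⟩
        have h1 : i < n := by omega
        have h2 : j < w.length := by omega
        simp [pent, rows, h1, h2]
      · rw [(hs i j).2 h]
        unfold pent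
        split_ifs with h0
        · rfl
        · by_cases h1 : i - 1 < n
          · simp [rows, List.getElem?_ofFn, h1]
            omega
          · simp [rows, h1]
    refine ⟨rows, n, ⟨hn, hm, hrl, hr, ?_⟩, ?_⟩
    · rw [tilesOf_framed rows _ hr]
      intro i hi j hj
      simp only [hpe]
      exact ht i (by omega) j hj
    · rw [List.head?_eq_getElem?]
      simp only [rows, List.getElem?_ofFn, hn, dif_pos, Option.some.injEq]
      apply List.ext_getElem
      · simp
      · intro j h1 h2
        simp only [List.length_map] at h2
        have := hf j _ (List.getElem?_eq_getElem h2)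
        simp [this]

/-! ### From rational graphs to tiling systems -/

/-- Run of a labelled transition relation. -/
def Run {σ X : Type} (δ : σ → X → σ → Prop) : σ → List X → σ → Prop
  | s, [], t => s = t
  | s, l :: ls, t => ∃ s', δ s l s' ∧ Run δ s' ls t

/-- Disjoint union of the transducers of a graph, with stuttering. -/
inductive STr {A Γ : Type} (H : RationalGraph A Γ) :
    (Σ a, (H.trans a).Q) → Option Γ × Option Γ → (Σ a, (H.trans a).Q) → Prop
  | mk (a : A) (q q' : (H.trans a).Q) (l : Option Γ × Option Γ) :
      (H.trans a).trans q l q' → STr H ⟨a, q⟩ l ⟨a, q'⟩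
  | stut (s : Σ a, (H.trans a).Q) : STr H s (none, none) s

theorem run_of_path {A Γ : Type} (H : RationalGraph A Γ) (a : A) (q q' : (H.trans a).Q)
    (ls : List (Option Γ × Option Γ)) (h : (H.trans a).Path q ls q') :
    Run (STr H) ⟨a, q⟩ ls ⟨a, q'⟩ := by
  induction h with
  | nil q => rfl
  | cons h1 _ ih => exact ⟨_, STr.mk _ _ _ _ h1, ih⟩

theorem path_of_run {A Γ : Type} (H : RationalGraph A Γ) (a : A)
    (t : Σ a, (H.trans a).Q) (ls : List (Option Γ × Option Γ)) :
    ∀ (q : (H.trans a).Q), Run (STr H) ⟨a, q⟩ ls t →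
    ∃ q' ls', t = ⟨a, q'⟩ ∧ (H.trans a).Path q ls' q' ∧
      Transducer.ins ls' = Transducer.ins ls ∧ Transducer.outs ls' = Transducer.outs ls := by
  induction ls with
  | nil =>
    intro q h
    exact ⟨q, [], h.symm, .nil _, rfl, rfl⟩
  | cons l ls ih =>
    rintro q ⟨s', hd, hr⟩
    cases hd with
    | mk _ _ q1 _ htr =>
      obtain ⟨q', ls', rfl, hp, hi, ho⟩ := ih _ hr
      refine ⟨q', l :: ls', rfl, .cons htr hp, ?_, ?_⟩
      · simpa [Transducer.ins] using hi
      · simpa [Transducer.outs] using ho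
    | stut =>
      obtain ⟨q', ls', rfl, hp, hi, ho⟩ := ih _ hr
      refine ⟨q', ls', rfl, hp, ?_, ?_⟩
      · simpa [Transducer.ins] using hi
      · simpa [Transducer.outs] using ho

/-- Label of column `k` in a global row. -/
def lab {Γ : Type} (k : ℕ) (ρ : ℕ → Option Γ) : Option Γ × Option Γ := (ρ k, ρ (k + 1))

theorem ins_map_lab {Γ : Type} (k : ℕ) (R : List (ℕ → Option Γ)) :
    Transducer.ins (R.map (lab k)) = R.filterMap (fun ρ => ρ k) := by
  induction R with
  | nil => rfl
  | cons ρ R ih =>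
    simp only [Transducer.ins, List.map_cons, List.flatMap_cons, List.filterMap_cons] at *
    rw [ih]
    cases h : ρ k <;> simp [lab, h]

theorem outs_map_lab {Γ : Type} (k : ℕ) (R : List (ℕ → Option Γ)) :
    Transducer.outs (R.map (lab k)) = R.filterMap (fun ρ => ρ (k + 1)) := by
  induction R with
  | nil => rfl
  | cons ρ R ih =>
    simp only [Transducer.outs, List.map_cons, List.flatMap_cons, List.filterMap_cons] at *
    rw [ih]
    cases h : ρ (k + 1) <;> simp [lab, h]

theorem merge_runs {σ Γ : Type} (δ : σ → Option Γ × Option Γ → σ → Prop)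
    (hδ : ∀ s, δ s (none, none) s) (m : ℕ) (ls : List (Option Γ × Option Γ)) :
    ∀ (R : List (ℕ → Option Γ)), Transducer.ins ls = R.filterMap (fun ρ => ρ m) →
    ∃ R' : List (ℕ → Option Γ),
      (∀ k ≤ m, R'.filterMap (fun ρ => ρ k) = R.filterMap (fun ρ => ρ k)) ∧
      R'.filterMap (fun ρ => ρ (m + 1)) = Transducer.outs ls ∧
      (∀ k < m, ∀ s t, Run δ s (R.map (lab k)) t → Run δ s (R'.map (lab k)) t) ∧
      (∀ s t, Run δ s ls t → Run δ s (R'.map (lab m)) t) := by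
  have hskip : ∀ (l : Option Γ × Option Γ) (ls : List (Option Γ × Option Γ)), l = (none, none) →
      ∀ s t, Run δ s ls t → Run δ s (l :: ls) t := by
    rintro l ls rfl s t h
    exact ⟨s, hδ s, h⟩
  have hkeep : ∀ (l l' : Option Γ × Option Γ) (ls ls' : List (Option Γ × Option Γ)), l = l' →
      (∀ s t, Run δ s ls t → Run δ s ls' t) →
      ∀ s t, Run δ s (l :: ls) t → Run δ s (l' :: ls') t := by
    rintro l _ ls ls' rfl h s t ⟨s', h1, h2⟩
    exact ⟨s', h1, h _ _ h2⟩
  induction ls with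
  | nil =>
    intro R
    induction R with
    | nil => intro _; exact ⟨[], by simp, rfl, by simp, by simp⟩
    | cons ρ R ihR =>
      intro h
      have hρ : ρ m = none := by
        cases h' : ρ m with
        | none => rfl
        | some c => simp [Transducer.ins, h'] at h
      obtain ⟨R', h1, h2, h3, h4⟩ := ihR (by simpa [hρ] using h)
      refine ⟨Function.update ρ (m + 1) none :: R', ?_, ?_, ?_, ?_⟩
      · intro k hk
        have : k ≠ m + 1 := by omega
        simp [List.filterMap_cons, h1 k hk, Function.update_of_ne this]
      · simpa using h2
      · intro k hk
        apply hkeep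
        · have a1 : k ≠ m + 1 := by omega
          have a2 : k ≠ m := by omega
          simp [lab, a1, a2]
        · exact h3 k hk
      · intro s t hst
        apply hskip
        · simp [lab, hρ]
        · exact h4 s t hst
  | cons l ls ih =>
    obtain ⟨x, y⟩ := l
    cases x with
    | none =>
      intro R h
      obtain ⟨R', h1, h2, h3, h4⟩ := ih R (by simpa [Transducer.ins] using h)
      refine ⟨(fun k => if k = m + 1 then y else none) :: R', ?_, ?_, ?_, ?_⟩
      · intro k hk
        have : k ≠ m + 1 := by omega
        simp [this, h1 k hk]
      · cases y <;> simp [Transducer.outs] at * <;> exact h2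
      · intro k hk s t hst
        apply hskip
        · have a1 : k ≠ m + 1 := by omega
          have a2 : k ≠ m := by omega
          simp [lab, a1, a2]
        · exact h3 k hk s t hst
      · apply hkeep
        · simp [lab]
        · exact h4
    | some c =>
      intro R
      induction R with
      | nil => intro h; simp [Transducer.ins] at h
      | cons ρ R ihR =>
        intro h
        cases hρ : ρ m with
        | none =>
          obtain ⟨R', h1, h2, h3, h4⟩ := ihR (by simpa [hρ] using h)
          refine ⟨Function.update ρ (m + 1) none :: R', ?_, ?_, ?_, ?_⟩
          · intro k hk
            have : k ≠ m + 1 := by omega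
            simp [List.filterMap_cons, h1 k hk, Function.update_of_ne this]
          · simpa using h2
          · intro k hk
            apply hkeep
            · have a1 : k ≠ m + 1 := by omega
              have a2 : k ≠ m := by omega
              simp [lab, a1, a2]
            · exact h3 k hk
          · intro s t hst
            apply hskip
            · simp [lab, hρ]
            · exact h4 s t hst
        | some c' =>
          have hcc : c = c' ∧ Transducer.ins ls = R.filterMap (fun ρ => ρ m) := by
            simpa [Transducer.ins, hρ] using h
          obtain ⟨rfl, h⟩ := hcc
          obtain ⟨R', h1, h2, h3, h4⟩ := ih R h
          refine ⟨Function.update ρ (m + 1) y :: R', ?_, ?_, ?_, ?_⟩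
          · intro k hk
            have : k ≠ m + 1 := by omega
            simp [List.filterMap_cons, h1 k hk, Function.update_of_ne this]
          · cases y <;> simp [Transducer.outs] at * <;> exact h2
          · intro k hk
            apply hkeep
            · have a1 : k ≠ m + 1 := by omega
              have a2 : k ≠ m := by omega
              simp [lab, a1, a2]
            · exact h3 k hk
          · apply hkeep
            · simp [lab, hρ]
            · exact h4

theorem align_runs {σ Γ : Type} (δ : σ → Option Γ × Option Γ → σ → Prop)
    (hδ : ∀ s, δ s (none, none) s) (v : ℕ → List Γ) (s t : ℕ → σ) (m : ℕ)
    (h : ∀ k < m, ∃ ls, Run δ (s k) ls (t k) ∧ Transducer.ins ls = v k ∧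
      Transducer.outs ls = v (k + 1)) :
    ∃ R : List (ℕ → Option Γ), (∀ k ≤ m, R.filterMap (fun ρ => ρ k) = v k) ∧
      ∀ k < m, Run δ (s k) (R.map (lab k)) (t k) := by
  induction m with
  | zero =>
    refine ⟨(v 0).map (fun c _ => some c), ?_, by simp⟩
    intro k hk
    obtain rfl : k = 0 := by omega
    simp [List.filterMap_map]
  | succ m ih =>
    obtain ⟨R, h1, h2⟩ := ih (fun k hk => h k (by omega))
    obtain ⟨ls, g1, g2, g3⟩ := h m (by omega)
    obtain ⟨R', k1, k2, k3, k4⟩ := merge_runs δ hδ m ls R (by rw [g2, h1 m le_rfl])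
    refine ⟨R', ?_, ?_⟩
    · intro k hk
      rcases Nat.lt_or_ge k (m + 1) with hlt | hge
      · rw [k1 k (by omega), h1 k (by omega)]
      · obtain rfl : k = m + 1 := by omega
        rw [k2, g3]
    · intro k hk
      rcases Nat.lt_or_ge k m with hlt | hge
      · exact k3 k hlt _ _ (h2 k hlt)
      · obtain rfl : k = m := by omega
        exact k4 _ _ g1

theorem run_iff_seq {σ X : Type} (δ : σ → X → σ → Prop) (ls : List X) :
    ∀ (s t : σ), Run δ s ls t ↔ ∃ f : ℕ → σ, f 0 = s ∧ f ls.length = t ∧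
      ∀ r l, ls[r]? = some l → δ (f r) l (f (r + 1)) := by
  induction ls with
  | nil =>
    intro s t
    constructor
    · intro h
      exact ⟨fun _ => s, rfl, h, by simp⟩
    · rintro ⟨f, h1, h2, _⟩
      exact h1.symm.trans h2
  | cons l ls ih =>
    intro s t
    constructor
    · rintro ⟨s', hd, hr⟩
      obtain ⟨f, h1, h2, h3⟩ := (ih _ _).1 hr
      refine ⟨fun r => if r = 0 then s else f (r - 1), by simp, by simp [h2], ?_⟩
      intro r l' hl
      rcases r with _ | r
      · simp at hl
        subst hl
        simpa [h1] using hd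
      · simpa using h3 r l' (by simpa using hl)
    · rintro ⟨f, h1, h2, h3⟩
      refine ⟨f 1, ?_, (ih _ _).2 ⟨fun r => f (r + 1), rfl, by simpa using h2, ?_⟩⟩
      · rw [← h1]
        exact h3 0 l rfl
      · intro r l' hl
        exact h3 (r + 1) l' (by simpa using hl)

/-- Grid of a domino system. -/
structure Grid {A C : Type} (ini : A → C → Prop) (V H : C → C → Prop) (fin finL finR : C → Prop)
    (w : List A) (n : ℕ) (c : ℕ → ℕ → C) : Prop where
  hini : ∀ k a, w[k]? = some a → ini a (c 0 k)
  hV : ∀ r < n, ∀ k < w.length, V (c r k) (c (r + 1) k)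
  hH : ∀ r ≤ n, ∀ k, k + 1 < w.length → H (c r k) (c r (k + 1))
  hfin : ∀ k < w.length, fin (c n k)
  hL : finL (c n 0)
  hR : finR (c n (w.length - 1))

/-- Vertical compatibility of the tiles of a domino system. -/
def dvert {A C : Type} (ini : A → C → Prop) (V : C → C → Prop) (fin : C → Prop) :
    Option (A ⊕ C) → Option (A ⊕ C) → Prop
  | some (.inl a), some (.inr c) => ini a c
  | some (.inr c), some (.inr c') => V c c'
  | some (.inr c), none => fin c
  | none, none => True
  | none, some (.inl _) => True
  | _, _ => False

/-- The tiling system of a domino system. -/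
def dominoSystem {A C : Type} (ini : A → C → Prop) (V H : C → C → Prop)
    (fin finL finR : C → Prop) : TilingSystem A (A ⊕ C) where
  emb := Sum.inl
  emb_inj := Sum.inl_injective
  tiles := { t | dvert ini V fin t.tl t.bl ∧ dvert ini V fin t.tr t.br ∧
    (∀ c c', t.bl = some (.inr c) → t.br = some (.inr c') → H c c') ∧
    (∀ c, t.tl = none → t.bl = none → t.tr = some (.inr c) → t.br = none → finL c) ∧
    (∀ c, t.tl = some (.inr c) → t.bl = none → t.tr = none → t.br = none → finR c) }

theorem mem_dominoSystem {A C : Type} (ini : A → C → Prop) (V H : C → C → Prop)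
    (fin finL finR : C → Prop) (w : List A) :
    w ∈ (dominoSystem ini V H fin finL finR).Lang ↔
      w ≠ [] ∧ ∃ n c, Grid ini V H fin finL finR w n c := by
  rw [TilingSystem.mem_lang_iff]
  constructor
  · rintro ⟨n, p, hn, hm, hs, ht, hf⟩
    refine ⟨by rintro rfl; simp at hm, ?_⟩
    have hv : ∀ i ≤ n, ∀ j ≤ w.length, dvert ini V fin (p i j) (p (i+1) j) :=
      fun i hi j hj => (ht i hi j hj).1
    have hn2 : 2 ≤ n := by
      by_contra hc
      obtain rfl : n = 1 := by omega
      have h1 := hv 1 le_rfl 1 (by omega)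
      rw [hf 0 w[0] (by simp [hm]), (hs 2 1).2 (by omega)] at h1
      exact h1
    have hinr : ∀ r, r + 2 ≤ n → ∀ k, k < w.length → ∃ c, p (r + 2) (k + 1) = some (.inr c) := by
      intro r hr k hk
      have hne : p (r + 2) (k + 1) ≠ none := by
        rw [Ne, hs]; omega
      have hne' : p (r + 1) (k + 1) ≠ none := by
        rw [Ne, hs]; omega
      have h1 := hv (r + 1) (by omega) (k + 1) (by omega)
      generalize p (r + 1 + 1) (k + 1) = x at h1 hne
      generalize p (r + 1) (k + 1) = y at h1 hne'
      rcases x with _ | a | c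
      · exact absurd rfl hne
      · rcases y with _ | _ | _
        · exact absurd rfl hne'
        · exact h1.elim
        · exact h1.elim
      · exact ⟨c, rfl⟩
    obtain ⟨c0, hc0⟩ := hinr 0 hn2 0 hm
    have hex : ∀ r k, ∃ c, r + 2 ≤ n → k < w.length → p (r + 2) (k + 1) = some (.inr c) := by
      intro r k
      by_cases h : r + 2 ≤ n ∧ k < w.length
      · obtain ⟨c, hc⟩ := hinr r h.1 k h.2
        exact ⟨c, fun _ _ => hc⟩
      · exact ⟨c0, fun h1 h2 => absurd ⟨h1, h2⟩ h⟩
    choose c hc using hex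
    refine ⟨n - 2, c, ?_, ?_, ?_, ?_, ?_, ?_⟩
    · intro k a hk
      have hkl : k < w.length := (List.getElem?_eq_some_iff.1 hk).1
      have h1 := hv 1 (by omega) (k + 1) (by omega)
      rw [hf k a hk, hc 0 k hn2 hkl] at h1
      exact h1
    · intro r hr k hk
      have h1 := hv (r + 2) (by omega) (k + 1) (by omega)
      rw [hc r k (by omega) hk, hc (r + 1) k (by omega) hk] at h1
      exact h1
    · intro r hr k hk
      exact (ht (r + 1) (by omega) (k + 1) (by omega)).2.2.1 _ _
        (hc r k (by omega) (by omega)) (hc r (k + 1) (by omega) hk)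
    · intro k hk
      have h1 := hv n le_rfl (k + 1) (by omega)
      have h2 := hc (n - 2) k (by omega) hk
      rw [show n - 2 + 2 = n by omega] at h2
      rw [h2, (hs (n + 1) (k + 1)).2 (by omega)] at h1
      exact h1
    · have h2 := hc (n - 2) 0 (by omega) hm
      rw [show n - 2 + 2 = n by omega] at h2
      exact (ht n le_rfl 0 (by omega)).2.2.2.1 _ ((hs _ _).2 (by omega)) ((hs _ _).2 (by omega))
        h2 ((hs _ _).2 (by omega))
    · have h2 := hc (n - 2) (w.length - 1) (by omega) (by omega)
      rw [show n - 2 + 2 = n by omega, show w.length - 1 + 1 = w.length by omega] at h2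
      exact (ht n le_rfl w.length le_rfl).2.2.2.2 _ h2 ((hs _ _).2 (by omega))
        ((hs _ _).2 (by omega)) ((hs _ _).2 (by omega))
  · rintro ⟨hw, n, c, hini, hV, hH, hfin, hL, hR⟩
    have hm : 0 < w.length := List.length_pos_iff.2 hw
    let p : ℕ → ℕ → Option (A ⊕ C) := fun i j =>
      if i = 0 ∨ n + 2 < i ∨ j = 0 then none
      else if i = 1 then w[j - 1]?.map .inl
      else if j ≤ w.length then some (.inr (c (i - 2) (j - 1))) else none
    have p_out : ∀ i j, ¬ (1 ≤ i ∧ i ≤ n + 2 ∧ 1 ≤ j ∧ j ≤ w.length) → p i j = none := by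
      intro i j h
      simp only [p]
      split_ifs
      · rfl
      · rw [List.getElem?_eq_none (by omega)]; rfl
      · omega
      · rfl
    have p_one : ∀ k, (h : k < w.length) → p 1 (k + 1) = some (.inl w[k]) := by
      intro k h
      simp [p, h]
    have p_two : ∀ r k, r ≤ n → k < w.length → p (r + 2) (k + 1) = some (.inr (c r k)) := by
      intro r k h1 h2
      have : ¬ (n < r) := by omega
      simp [p, this]
      omega
    have hvert : ∀ i ≤ n + 2, ∀ j, dvert ini V fin (p i j) (p (i + 1) j) := by
      intro i hi j
      by_cases hj : 1 ≤ j ∧ j ≤ w.length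
      · obtain ⟨k, rfl⟩ : ∃ k, j = k + 1 := ⟨j - 1, by omega⟩
        have hk : k < w.length := by omega
        rcases i with _ | _ | r
        · rw [p_out 0 _ (by omega), p_one k hk]; trivial
        · rw [p_one k hk, p_two 0 k (by omega) hk]
          exact hini k _ (by simp [hk])
        · rw [p_two r k (by omega) hk]
          rcases Nat.lt_or_ge r n with hlt | hge
          · rw [p_two (r + 1) k (by omega) hk]
            exact hV r hlt k hk
          · rw [p_out (r + 1 + 1 + 1) (k + 1) (by omega)]
            obtain rfl : r = n := by omega
            exact hfin k hk
      · rw [p_out i j (by omega), p_out (i + 1) j (by omega)]; trivial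
    refine ⟨n + 2, p, by omega, hm, ?_, ?_, ?_⟩
    · intro i j
      constructor
      · intro h hc
        obtain ⟨k, rfl⟩ : ∃ k, j = k + 1 := ⟨j - 1, by omega⟩
        rcases i with _ | _ | r
        · omega
        · rw [p_one k (by omega)] at h; simp at h
        · rw [p_two r k (by omega) (by omega)] at h; simp at h
      · exact p_out i j
    · intro i hi j hj
      refine ⟨hvert i hi j, hvert i hi (j + 1), ?_, ?_, ?_⟩
      · intro d d' h1 h2
        simp only at h1 h2
        by_cases hc : i + 1 ≤ n + 2 ∧ 1 ≤ j ∧ j + 1 ≤ w.length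
        · obtain ⟨k, rfl⟩ : ∃ k, j = k + 1 := ⟨j - 1, by omega⟩
          rcases i with _ | r
          · rw [p_one k (by omega)] at h1; simp at h1
          · rw [p_two r k (by omega) (by omega)] at h1
            rw [p_two r (k + 1) (by omega) (by omega)] at h2
            simp only [Option.some.injEq, Sum.inr.injEq] at h1 h2
            subst h1 h2
            exact hH r (by omega) k (by omega)
        · by_cases hc2 : i + 1 ≤ n + 2 ∧ 1 ≤ j ∧ j ≤ w.length
          · rw [p_out (i + 1) (j + 1) (by omega)] at h2; simp at h2
          · rw [p_out (i + 1) j (by omega)] at h1; simp at h1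
      · intro d h1 h2 h3 h4
        simp only at h1 h2 h3 h4
        by_cases hc : 1 ≤ i ∧ j + 1 ≤ w.length
        · rcases i with _ | _ | r
          · omega
          · rw [p_one j (by omega)] at h3; simp at h3
          · rw [p_two r j (by omega) (by omega)] at h3
            rcases Nat.lt_or_ge r n with hlt | hge
            · rw [p_two (r + 1) j (by omega) (by omega)] at h4; simp at h4
            · obtain rfl : r = n := by omega
              rcases j with _ | k
              · simp only [Option.some.injEq, Sum.inr.injEq] at h3
                subst h3
                exact hL
              · rw [p_two r k (by omega) (by omega)] at h1; simp at h1
        · rw [p_out i (j + 1) (by omega)] at h3; simp at h3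
      · intro d h1 h2 h3 h4
        simp only at h1 h2 h3 h4
        by_cases hc : 1 ≤ i ∧ 1 ≤ j
        · obtain ⟨k, rfl⟩ : ∃ k, j = k + 1 := ⟨j - 1, by omega⟩
          rcases i with _ | _ | r
          · omega
          · rw [p_one k (by omega)] at h1; simp at h1
          · rw [p_two r k (by omega) (by omega)] at h1
            rcases Nat.lt_or_ge r n with hlt | hge
            · rw [p_two (r + 1) k (by omega) (by omega)] at h2; simp at h2
            · obtain rfl : r = n := by omega
              rcases Nat.lt_or_ge (k + 1) w.length with hlt | hge
              · rw [p_two r (k + 1) (by omega) (by omega)] at h3; simp at h3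
              · simp only [Option.some.injEq, Sum.inr.injEq] at h1
                subst h1
                rw [show k = w.length - 1 by omega]
                exact hR
        · rw [p_out i j (by omega)] at h1; simp at h1
    · intro j a h
      have hk := (List.getElem?_eq_some_iff.1 h)
      rw [p_one j hk.1, hk.2]
      rfl

theorem regular_singleton {Γ : Type} (i : List Γ) : Regular ({i} : Set (List Γ)) := by
  have h : Language.IsRegular ({i} : Set (List Γ)) := by
    apply Language.IsRegular.of_finite_range_leftQuotient
    refine Set.Finite.subset (s := insert (∅ : Set (List Γ))
      ((fun k => ({i.drop k} : Set (List Γ))) '' Set.Iic i.length)) ?_ ?_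
    · exact ((Set.finite_Iic _).image _).insert _
    · rintro _ ⟨x, rfl⟩
      by_cases hx : x <+: i
      · obtain ⟨y, rfl⟩ := hx
        right
        refine ⟨x.length, by simp, ?_⟩
        ext z
        change z ∈ ({List.drop x.length (x ++ y)} : Set (List Γ)) ↔
          x ++ z ∈ ({x ++ y} : Set (List Γ))
        simp
      · left
        ext z
        change x ++ z ∈ ({i} : Set (List Γ)) ↔ z ∈ (∅ : Set (List Γ))
        simp only [Set.mem_singleton_iff, Set.mem_empty_iff_false, iff_false]
        rintro rfl
        exact hx ⟨z, rfl⟩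
  obtain ⟨σ, hσ, M, hM⟩ := h
  exact ⟨σ, hσ, M, hM⟩

/-- Optional step of a DFA. -/
def ost {Γ σ : Type} (M : DFA Γ σ) (d : σ) (o : Option Γ) : σ := o.elim d (M.step d)

/-- Word read in the first `r` rows of a column. -/
def colp {Γ : Type} (ρ : ℕ → ℕ → Option Γ) (k r : ℕ) : List Γ :=
  ((List.range r).map ρ).filterMap fun x => x k

theorem eval_colp_succ {Γ σ : Type} (M : DFA Γ σ) (ρ : ℕ → ℕ → Option Γ) (k r : ℕ) :
    M.eval (colp ρ k (r + 1)) = ost M (M.eval (colp ρ k r)) (ρ r k) := by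
  simp only [colp, List.range_succ, List.map_append, List.filterMap_append]
  cases h : ρ r k <;> simp [h, ost]

theorem eval_colp {Γ σ : Type} (M : DFA Γ σ) (ρ : ℕ → ℕ → Option Γ) (k n : ℕ) (f : ℕ → σ)
    (h0 : f 0 = M.start) (h : ∀ r < n, f (r + 1) = ost M (f r) (ρ r k)) :
    f n = M.eval (colp ρ k n) := by
  induction n with
  | zero => simpa [colp] using h0
  | succ n ih =>
    rw [eval_colp_succ, h n (by omega), ih fun r hr => h r (by omega)]

theorem tiling_of_graph {A Γ : Type} [Fintype A] [Fintype Γ] (H : RationalGraph A Γ)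
    (i : List Γ) (F : Set (List Γ)) (hF : Regular F) (hne : [] ∉ H.Lang {i} F) :
    ∃ (Λ : Type) (_ : Fintype Λ) (S : TilingSystem A Λ), S.Lang = H.Lang {i} F := by
  obtain ⟨σI, hσI, MI, hMI⟩ := regular_singleton i
  obtain ⟨σF, hσF, MF, hMF⟩ := hF
  have : ∀ a, Fintype (H.trans a).Q := fun a => (H.trans a).fintypeQ
  let C := (Σ a, (H.trans a).Q) × (Option Γ × Option Γ) × σI × σF
  let ini : A → C → Prop := fun a c =>
    c.1 = ⟨a, (H.trans a).init⟩ ∧ c.2.2.1 = MI.start ∧ c.2.2.2 = MF.start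
  let V : C → C → Prop := fun c c' => STr H c.1 c.2.1 c'.1 ∧
    c'.2.2.1 = ost MI c.2.2.1 c.2.1.1 ∧ c'.2.2.2 = ost MF c.2.2.2 c.2.1.2
  let Hh : C → C → Prop := fun c c' => c.2.1.2 = c'.2.1.1
  let fin : C → Prop := fun c => c.1.2 ∈ (H.trans c.1.1).final
  let finL : C → Prop := fun c => c.2.2.1 ∈ MI.accept
  let finR : C → Prop := fun c => c.2.2.2 ∈ MF.accept
  have hMI' : ∀ u, MI.eval u ∈ MI.accept ↔ u = i := by
    intro u
    have : u ∈ MI.accepts ↔ u = i := by rw [hMI]; exact Set.mem_singleton_iff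
    exact this
  have hMF' : ∀ u, MF.eval u ∈ MF.accept ↔ u ∈ F := by
    intro u
    have : u ∈ MF.accepts ↔ u ∈ F := by rw [hMF]; rfl
    exact this
  refine ⟨A ⊕ C, inferInstance, dominoSystem ini V Hh fin finL finR, ?_⟩
  ext w
  rw [mem_dominoSystem]
  constructor
  · rintro ⟨hw, n, c, hini, hV, hH, hfin, hL, hR⟩
    have hm : 0 < w.length := List.length_pos_iff.2 hw
    rw [RationalGraph.mem_lang_iff]
    let ρ : ℕ → ℕ → Option Γ := fun r k => if k = 0 then (c r 0).2.1.1 else (c r (k - 1)).2.1.2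
    have hρ : ∀ r ≤ n, ∀ k < w.length, lab k (ρ r) = (c r k).2.1 := by
      intro r hr k hk
      rcases k with _ | k
      · simp [lab, ρ]
      · have := hH r hr k hk
        simp only [lab, ρ]
        simp only [Nat.add_eq_zero_iff, one_ne_zero, and_false, if_false, Nat.add_sub_cancel]
        rw [this]
    refine ⟨fun k => colp ρ k n, ?_, ?_, ?_⟩
    · rw [← hMI', ← eval_colp MI ρ 0 n (fun r => (c r 0).2.2.1)]
      · exact hL
      · exact (hini 0 w[0] (by simp [hm])).2.1
      · intro r hr
        exact (hV r hr 0 hm).2.1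
    · intro k a hk
      have hkl : k < w.length := (List.getElem?_eq_some_iff.1 hk).1
      have hrun : Run (STr H) ⟨a, (H.trans a).init⟩ (((List.range n).map ρ).map (lab k))
          (c n k).1 := by
        rw [run_iff_seq]
        refine ⟨fun r => (c r k).1, (hini k a hk).1, by simp, ?_⟩
        intro r l hl
        have hr : r < n := by
          have := (List.getElem?_eq_some_iff.1 hl).1
          simpa using this
        have : l = (c r k).2.1 := by
          rw [← hρ r hr.le k hkl]
          simpa [hr, eq_comm] using hl
        rw [this]
        exact (hV r hr k hkl).1
      obtain ⟨q', ls', h1, h2, h3, h4⟩ := path_of_run H a _ _ _ hrun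
      refine ⟨q', ls', h2, ?_, ?_, ?_⟩
      · have := hfin k hkl
        simp only [fin] at this
        rw [h1] at this
        exact this
      · rw [h3, ins_map_lab]; rfl
      · rw [h4, outs_map_lab]; rfl
    · rw [← hMF', ← eval_colp MF ρ w.length n (fun r => (c r (w.length - 1)).2.2.2)]
      · exact hR
      · exact (hini (w.length - 1) w[w.length - 1] (by simp [hm])).2.2
      · intro r hr
        rw [(hV r hr (w.length - 1) (by omega)).2.2]
        have : ¬ (w.length = 0) := by omega
        simp only [ρ, this, if_false]
  · intro hw
    have hw0 : w ≠ [] := by rintro rfl; exact hne hw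
    have hm : 0 < w.length := List.length_pos_iff.2 hw0
    refine ⟨hw0, ?_⟩
    rw [RationalGraph.mem_lang_iff] at hw
    obtain ⟨vs, h0, hE, hf⟩ := hw
    have hex : ∀ k, ∃ t : Σ a, (H.trans a).Q, k < w.length → (t.2 ∈ (H.trans t.1).final ∧
        ∃ ls, Run (STr H) ⟨w.getD k w[0], (H.trans _).init⟩ ls t ∧ Transducer.ins ls = vs k ∧
          Transducer.outs ls = vs (k + 1)) := by
      intro k
      by_cases hk : k < w.length
      · obtain ⟨q, ls, h1, h2, h3, h4⟩ := hE k (w.getD k w[0])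
          (by simp [List.getD_eq_getElem?_getD, hk])
        exact ⟨⟨_, q⟩, fun _ => ⟨h2, ls, run_of_path H _ _ _ _ h1, h3, h4⟩⟩
      · exact ⟨⟨w[0], (H.trans _).init⟩, fun h => absurd h hk⟩
    choose t ht using hex
    obtain ⟨R, hR1, hR2⟩ := align_runs (STr H) STr.stut vs
      (fun k => ⟨w.getD k w[0], (H.trans _).init⟩) t w.length (fun k hk => (ht k hk).2)
    have hex2 : ∀ k, ∃ f : ℕ → Σ a, (H.trans a).Q, k < w.length →
        f 0 = ⟨w.getD k w[0], (H.trans _).init⟩ ∧ f R.length = t k ∧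
        ∀ r l, (R.map (lab k))[r]? = some l → STr H (f r) l (f (r + 1)) := by
      intro k
      by_cases hk : k < w.length
      · obtain ⟨f, h1, h2, h3⟩ := (run_iff_seq _ _ _ _).1 (hR2 k hk)
        exact ⟨f, fun _ => ⟨h1, by simpa using h2, h3⟩⟩
      · exact ⟨fun _ => t 0, fun h => absurd h hk⟩
    choose f hfk using hex2
    let ρ : ℕ → ℕ → Option Γ := fun r => R.getD r (fun _ => none)
    have hRρ : (List.range R.length).map ρ = R := by
      apply List.ext_getElem
      · simp
      · intro r h1 h2
        simp [ρ, List.getD_eq_getElem?_getD, h2]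
    have hcol : ∀ k ≤ w.length, colp ρ k R.length = vs k := by
      intro k hk
      rw [colp, hRρ, hR1 k hk]
    let c : ℕ → ℕ → C := fun r k =>
      (f k r, lab k (ρ r), MI.eval (colp ρ k r), MF.eval (colp ρ (k + 1) r))
    refine ⟨R.length, c, ?_, ?_, ?_, ?_, ?_, ?_⟩
    · intro k a hk
      have hkl := (List.getElem?_eq_some_iff.1 hk).1
      refine ⟨?_, by simp [c, colp], by simp [c, colp]⟩
      simp only [c]
      rw [(hfk k hkl).1]
      have : w.getD k w[0] = a := by simp [List.getD_eq_getElem?_getD, hk]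
      rw [this]
    · intro r hr k hk
      refine ⟨(hfk k hk).2.2 r _ ?_, eval_colp_succ _ _ _ _, eval_colp_succ _ _ _ _⟩
      simp [c, ρ, List.getD_eq_getElem?_getD, hr]
    · intro r hr k hk
      rfl
    · intro k hk
      simp only [fin, c]
      rw [(hfk k hk).2.1]
      exact (ht k hk).1
    · simp only [finL, c]
      rw [hMI', hcol 0 (by omega), h0]
    · simp only [finR, c]
      rw [hMF', show w.length - 1 + 1 = w.length by omega, hcol _ le_rfl]
      exact hf

/-! ### From tiling systems to rational graphs -/

theorem FPic.exists_bounded {A Λ : Type} [Fintype Λ] (S : TilingSystem A Λ) (w : List A)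
    (h : ∃ n p, FPic S w n p) :
    ∃ n p, FPic S w n p ∧ n ≤ (Fintype.card Λ + 1) ^ w.length := by
  classical
  obtain ⟨p, hp⟩ := Nat.find_spec h
  have hmin : ∀ n', n' < Nat.find h → ¬ ∃ p, FPic S w n' p := fun n' hn' => Nat.find_min h hn'
  generalize Nat.find h = n at hp hmin
  refine ⟨n, p, hp, ?_⟩
  have hinj : Function.Injective
      (fun (r : Fin n) (k : Fin w.length) => p (r + 1) (k + 1)) := by
    by_contra hc
    have : ∃ i j : ℕ, i < j ∧ 1 ≤ i ∧ j ≤ n ∧ p i = p j := by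
      rw [Function.not_injective_iff] at hc
      obtain ⟨a, b, hab, hne⟩ := hc
      have hrow : p (a + 1) = p (b + 1) := by
        funext j
        by_cases hj : 1 ≤ j ∧ j ≤ w.length
        · have := congrFun hab ⟨j - 1, by omega⟩
          simpa [show j - 1 + 1 = j by omega] using this
        · rw [(hp.shape _ _).2 (by omega), (hp.shape _ _).2 (by omega)]
      have hne' : (a : ℕ) ≠ b := fun h => hne (Fin.ext h)
      rcases Nat.lt_or_gt_of_ne hne' with h | h
      · exact ⟨a + 1, b + 1, by omega, by omega, by omega, hrow⟩
      · exact ⟨b + 1, a + 1, by omega, by omega, by omega, hrow.symm⟩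
    obtain ⟨i, j, hij, hi, hj, hrow⟩ := this
    apply hmin (n - (j - i)) (by omega)
    refine ⟨fun r => if r ≤ i then p r else p (r + (j - i)), by omega, hp.mpos, ?_, ?_, ?_⟩
    · intro r k
      by_cases hr : r ≤ i
      · simp only [hr, if_true]
        rw [hp.shape]; omega
      · simp only [hr, if_false]
        rw [hp.shape]; omega
    · intro r hr k hk
      rcases Nat.lt_trichotomy r i with h | h | h
      · simp only [show r ≤ i by omega, show r + 1 ≤ i by omega, if_true]
        exact hp.tile r (by omega) k hk
      · subst h
        simp only [le_refl, if_true, show ¬ (r + 1 ≤ r) by omega, if_false]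
        rw [hrow, show r + 1 + (j - r) = j + 1 by omega]
        exact hp.tile j (by omega) k hk
      · simp only [show ¬ (r ≤ i) by omega, show ¬ (r + 1 ≤ i) by omega, if_false]
        rw [show r + 1 + (j - i) = r + (j - i) + 1 by omega]
        exact hp.tile _ (by omega) k hk
    · intro k a hk
      simp only [hi, if_true]
      exact hp.first k a hk
  have := Fintype.card_le_of_injective _ hinj
  simpa using this

/-- Chains of a step relation starting and ending with the border `none`. -/
def CH {G : Type} (step : Option G → Option G → Prop) : Option G → List G → Prop
  | p, [] => step p none
  | p, g :: z => step p (some g) ∧ CH step (some g) z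

/-- Column function of a list, with border. -/
def pv {G : Type} (z : List G) (i : ℕ) : Option G := if i = 0 then none else z[i - 1]?

theorem pv_zero {G : Type} (z : List G) : pv z 0 = none := rfl

theorem pv_succ {G : Type} (z : List G) (i : ℕ) : pv z (i + 1) = z[i]? := rfl

theorem pv_map {G G' : Type} (f : G → G') (z : List G) (i : ℕ) :
    pv (z.map f) i = (pv z i).map f := by
  cases i <;> simp [pv]

theorem pv_eq_none {G : Type} (z : List G) (i : ℕ) : pv z i = none ↔ i = 0 ∨ z.length < i := by
  cases i <;> simp [pv]

theorem CH_iff_aux {G : Type} (step : Option G → Option G → Prop) (z : List G) :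
    ∀ p, CH step p z ↔ ∀ i ≤ z.length, step (if i = 0 then p else z[i - 1]?) z[i]? := by
  induction z with
  | nil =>
    intro p
    simp [CH]
  | cons g z ih =>
    intro p
    simp only [CH, ih]
    constructor
    · rintro ⟨h1, h2⟩ i hi
      rcases i with _ | i
      · simpa using h1
      · have := h2 i (by simpa using hi)
        rcases i with _ | i
        · simpa using this
        · simpa using this
    · intro h
      refine ⟨by simpa using h 0 (by simp), ?_⟩
      intro i hi
      have := h (i + 1) (by simpa using hi)
      rcases i with _ | i
      · simpa using this
      · simpa using this

theorem CH_iff {G : Type} (step : Option G → Option G → Prop) (z : List G) :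
    CH step none z ↔ ∀ i ≤ z.length, step (pv z i) (pv z (i + 1)) := CH_iff_aux step z none

/-- Modes of the phase-2 edges. -/
inductive Md (A : Type)
  | sw : Md A
  | sw2 (y : A) : Md A
  | pop (y : A) : Md A

/-- Row data: optional input pair and output pair. -/
abbrev RowG (Λ : Type) : Type := Option (Λ × Λ) × (Λ × Λ)

/-- States of the edge transducers. -/
inductive St (A Λ : Type) (c : ℕ)
  | start : St A Λ c
  | cp : St A Λ c
  | grow (j : Fin (c + 1)) : St A Λ c
  | cm (μ : Md A) : St A Λ c
  | rw (μ : Md A) (p : Option (RowG Λ)) : St A Λ c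

instance {A : Type} [Finite A] : Finite (Md A) := by
  refine Finite.of_injective (β := Option (A ⊕ A))
    (fun μ => match μ with
      | .sw => none
      | .sw2 y => some (.inl y)
      | .pop y => some (.inr y)) ?_
  intro a b h
  cases a <;> cases b <;> simp_all

instance {A Λ : Type} [Finite A] [Finite Λ] (c : ℕ) : Finite (St A Λ c) := by
  refine Finite.of_injective (β := Option (Option (Fin (c + 1) ⊕ Md A ⊕ Md A × Option (RowG Λ))))
    (fun μ => match μ with
      | .start => none
      | .cp => some none
      | .grow j => some (some (.inl j))
      | .cm μ => some (some (.inr (.inl μ)))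
      | .rw μ p => some (some (.inr (.inr (μ, p))))) ?_
  intro a b h
  cases a <;> cases b <;> simp_all

section
variable {A Λ : Type} (S : TilingSystem A Λ)

/-- Horizontal adjacency of two framed columns of height `n`. -/
def HAdj (n : ℕ) (f g : ℕ → Option Λ) : Prop :=
  ∀ i ≤ n, (⟨f i, g i, f (i + 1), g (i + 1)⟩ : Tile (Option Λ)) ∈ S.tiles

/-- Column of height `n` with first letter `x`. -/
def IsCol (n : ℕ) (x : A) (f : ℕ → Option Λ) : Prop :=
  f 1 = some (S.emb x) ∧ ∀ i, f i = none ↔ (i = 0 ∨ n < i)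

/-- Shape of the rows in each mode. -/
def shapeM : Md A → RowG Λ → Prop
  | .sw, g => g.1 = none ∧ g.2.1 = g.2.2
  | .sw2 _, g => g.1 = none
  | .pop _, g => g.1 ≠ none

/-- Letter of the new left column. -/
def leftLetter (x : A) : Md A → A
  | .sw => x
  | .sw2 y => y
  | .pop y => y

/-- Tile constraints in each mode. -/
def tileM : Md A → Option (RowG Λ) → Option (RowG Λ) → Prop
  | .sw, _, _ => True
  | .sw2 _, p, q => (⟨p.map (·.2.1), p.map (·.2.2), q.map (·.2.1), q.map (·.2.2)⟩ :
      Tile (Option Λ)) ∈ S.tiles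
  | .pop _, p, q => (⟨p.map (·.2.1), (p.bind (·.1)).map Prod.fst,
      q.map (·.2.1), (q.bind (·.1)).map Prod.fst⟩ : Tile (Option Λ)) ∈ S.tiles ∧
      (⟨(p.bind (·.1)).map Prod.snd, p.map (·.2.2), (q.bind (·.1)).map Prod.snd, q.map (·.2.2)⟩ :
      Tile (Option Λ)) ∈ S.tiles

/-- Row step relation. -/
def mstep (x : A) (μ : Md A) (p q : Option (RowG Λ)) : Prop :=
  (∀ g, q = some g → shapeM μ g) ∧
  (p = none → q.map (·.2.1) = some (S.emb (leftLetter x μ)) ∧ q.map (·.2.2) = some (S.emb x)) ∧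
  tileM S μ p q

theorem CH_mstep_iff (x : A) (μ : Md A) (z : List (RowG Λ)) :
    CH (mstep S x μ) none z ↔ (∀ g ∈ z, shapeM μ g) ∧
      (pv (z.map (·.2.1)) 1 = some (S.emb (leftLetter x μ)) ∧
       pv (z.map (·.2.2)) 1 = some (S.emb x)) ∧
      ∀ i ≤ z.length, tileM S μ (pv z i) (pv z (i + 1)) := by
  rw [CH_iff]
  simp only [pv_map]
  constructor
  · intro h
    refine ⟨?_, (h 0 (by omega)).2.1 rfl, fun i hi => (h i hi).2.2⟩
    intro g hg
    obtain ⟨i, hi, rfl⟩ := List.mem_iff_getElem.1 hg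
    exact (h i hi.le).1 _ (by simp [pv_succ, hi])
  · rintro ⟨h1, h2, h3⟩ i hi
    refine ⟨?_, ?_, h3 i hi⟩
    · intro g hg
      exact h1 g (List.mem_of_getElem? hg)
    · intro hp
      rw [pv_eq_none] at hp
      obtain rfl : i = 0 := by omega
      exact h2

/-- Transitions of the edge transducer for the letter `x`. -/
inductive Tr (c : ℕ) (x : A) : St A Λ c →
    Option (A ⊕ Option (Λ × Λ)) × Option (A ⊕ Option (Λ × Λ)) → St A Λ c → Prop
  | push : Tr c x .start (none, some (.inl x)) .cp
  | cp (a : A) : Tr c x .cp (some (.inl a), some (.inl a)) .cp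
  | cpEnd : Tr c x .cp (none, none) (.grow 0)
  | growIn (j : Fin (c + 1)) : Tr c x (.grow j) (some (.inr none), none) (.grow (Fin.last c))
  | growOut (j j' : Fin (c + 1)) (h : j'.val + 1 = j.val) :
      Tr c x (.grow j) (none, some (.inr none)) (.grow j')
  | toSw : Tr c x .start (none, none) (.cm .sw)
  | toSw2 (y : A) : Tr c x .start (some (.inl y), none) (.cm (.sw2 y))
  | toPop (y : A) : Tr c x .start (some (.inl y), none) (.cm (.pop y))
  | cm (μ : Md A) (a : A) : Tr c x (.cm μ) (some (.inl a), some (.inl a)) (.cm μ)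
  | cmEnd (μ : Md A) : Tr c x (.cm μ) (none, none) (.rw μ none)
  | skip (μ : Md A) (p : Option (RowG Λ)) :
      Tr c x (.rw μ p) (some (.inr none), none) (.rw μ p)
  | row (μ : Md A) (p : Option (RowG Λ)) (g : RowG Λ) (h : mstep S x μ p (some g)) :
      Tr c x (.rw μ p) (some (.inr g.1), some (.inr (some g.2))) (.rw μ (some g))

/-- Final states. -/
def finSt (c : ℕ) (x : A) : St A Λ c → Prop
  | .grow _ => True
  | .rw μ p => mstep S x μ p none
  | _ => False

/-- The edge transducer for the letter `x`. -/
noncomputable def edgeT [Finite A] [Finite Λ] (c : ℕ) (x : A) :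
    Transducer (A ⊕ Option (Λ × Λ)) where
  Q := St A Λ c
  fintypeQ := Fintype.ofFinite _
  init := .start
  final := { q | finSt S c x q }
  trans := Tr S c x

/-- The graph of a tiling system. -/
noncomputable def tilingGraph [Finite A] [Finite Λ] (c : ℕ) :
    RationalGraph A (A ⊕ Option (Λ × Λ)) where
  trans := edgeT S c

/-- Embedding of stacks and column words into vertices. -/
def vtx (s : List A) (t : List (Option (Λ × Λ))) : List (A ⊕ Option (Λ × Λ)) :=
  s.map .inl ++ t.map .inr

theorem vtx_inj {s s' : List A} {t t' : List (Option (Λ × Λ))} (h : vtx s t = vtx s' t') :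
    s = s' ∧ t = t' := by
  constructor
  · have := congrArg (List.filterMap Sum.getLeft?) h
    simpa [vtx, List.filterMap_append, List.filterMap_map, Function.comp_def] using this
  · have := congrArg (List.filterMap Sum.getRight?) h
    simpa [vtx, List.filterMap_append, List.filterMap_map, Function.comp_def] using this

theorem vtx_cons (a : A) (s : List A) (t : List (Option (Λ × Λ))) :
    vtx (a :: s) t = .inl a :: vtx s t := rfl

/-- Specification of runs from a row state. -/
def SpecRw (x : A) (μ : Md A) (p : Option (RowG Λ)) (u v : List (A ⊕ Option (Λ × Λ))) : Prop :=
  ∃ z t, CH (mstep S x μ) p z ∧ u = vtx [] t ∧ v = vtx [] (z.map fun g => some g.2) ∧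
    t.reduceOption = z.filterMap Prod.fst

/-- Specification of runs from a stack-copying state. -/
def SpecCm (x : A) (μ : Md A) (u v : List (A ⊕ Option (Λ × Λ))) : Prop :=
  ∃ s z t, CH (mstep S x μ) none z ∧ u = vtx s t ∧ v = vtx s (z.map fun g => some g.2) ∧
    t.reduceOption = z.filterMap Prod.fst

/-- Specification of runs from the pushing state. -/
def SpecCp (u v : List (A ⊕ Option (Λ × Λ))) : Prop :=
  ∃ s N M, u = vtx s (List.replicate N none) ∧ v = vtx s (List.replicate M none)

/-- Specification of accepting runs from each state. -/
def Spec (c : ℕ) (x : A) : St A Λ c → List (A ⊕ Option (Λ × Λ)) →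
    List (A ⊕ Option (Λ × Λ)) → Prop
  | .start, u, v => (∃ v', v = .inl x :: v' ∧ SpecCp u v') ∨ SpecCm S x .sw u v ∨
      ∃ y u', u = .inl y :: u' ∧ (SpecCm S x (.sw2 y) u' v ∨ SpecCm S x (.pop y) u' v)
  | .cp, u, v => SpecCp u v
  | .grow _, u, v => ∃ N M, u = vtx [] (List.replicate N none) ∧ v = vtx [] (List.replicate M none)
  | .cm μ, u, v => SpecCm S x μ u v
  | .rw μ p, u, v => SpecRw S x μ p u v

theorem spec_final (c : ℕ) (x : A) (q : St A Λ c) (h : finSt S c x q) : Spec S c x q [] [] := by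
  cases q with
  | start => exact h.elim
  | cp => exact h.elim
  | grow j => exact ⟨0, 0, rfl, rfl⟩
  | cm μ => exact h.elim
  | rw μ p => exact ⟨[], [], h, rfl, rfl, rfl⟩

theorem spec_step (c : ℕ) (x : A) (q q' : St A Λ c)
    (l : Option (A ⊕ Option (Λ × Λ)) × Option (A ⊕ Option (Λ × Λ)))
    (u v : List (A ⊕ Option (Λ × Λ))) (h : Tr S c x q l q') (hs : Spec S c x q' u v) :
    Spec S c x q (l.1.toList ++ u) (l.2.toList ++ v) := by
  cases h with
  | push => exact Or.inl ⟨v, rfl, hs⟩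
  | cp a =>
    obtain ⟨s, N, M, rfl, rfl⟩ := hs
    exact ⟨a :: s, N, M, rfl, rfl⟩
  | cpEnd =>
    obtain ⟨N, M, rfl, rfl⟩ := hs
    exact ⟨[], N, M, rfl, rfl⟩
  | growIn j =>
    obtain ⟨N, M, rfl, rfl⟩ := hs
    exact ⟨N + 1, M, rfl, rfl⟩
  | growOut j j' h =>
    obtain ⟨N, M, rfl, rfl⟩ := hs
    exact ⟨N, M + 1, rfl, rfl⟩
  | toSw => exact Or.inr (Or.inl hs)
  | toSw2 y => exact Or.inr (Or.inr ⟨y, u, rfl, Or.inl hs⟩)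
  | toPop y => exact Or.inr (Or.inr ⟨y, u, rfl, Or.inr hs⟩)
  | cm μ a =>
    obtain ⟨s, z, t, h1, rfl, rfl, h2⟩ := hs
    exact ⟨a :: s, z, t, h1, rfl, rfl, h2⟩
  | cmEnd μ =>
    obtain ⟨z, t, h1, rfl, rfl, h2⟩ := hs
    exact ⟨[], z, t, h1, rfl, rfl, h2⟩
  | skip μ p =>
    obtain ⟨z, t, h1, rfl, rfl, h2⟩ := hs
    exact ⟨z, none :: t, h1, rfl, rfl, by simpa using h2⟩
  | row μ p g h =>
    obtain ⟨z, t, h1, rfl, rfl, h2⟩ := hs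
    refine ⟨g :: z, g.1 :: t, ⟨h, h1⟩, rfl, rfl, ?_⟩
    rcases g with ⟨_ | a, b⟩
    · simpa using h2
    · simpa using h2

theorem spec_path [Finite A] [Finite Λ] (c : ℕ) (x : A) (q q' : (edgeT S c x).Q)
    (ls : List (Option (A ⊕ Option (Λ × Λ)) × Option (A ⊕ Option (Λ × Λ))))
    (h : (edgeT S c x).Path q ls q') (hq : q' ∈ (edgeT S c x).final) :
    Spec S c x q (Transducer.ins ls) (Transducer.outs ls) := by
  induction h with
  | nil q => exact spec_final S c x q hq
  | cons h1 _ ih =>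
    have := spec_step S c x _ _ _ _ _ h1 (ih hq)
    simpa [Transducer.ins, Transducer.outs] using this

theorem spec_edge [Finite A] [Finite Λ] (c : ℕ) (x : A) (u v : List (A ⊕ Option (Λ × Λ)))
    (h : (tilingGraph S c).Edge u x v) : Spec S c x .start u v := by
  obtain ⟨q, ls, h1, h2, rfl, rfl⟩ := h
  exact spec_path S c x _ _ _ h1 h2

/-- Potential bounding the number of letters output without reading. -/
def pot (c : ℕ) : St A Λ c → ℕ
  | .start => 1
  | .grow j => j
  | _ => 0

theorem pot_step (c : ℕ) (x : A) (q q' : St A Λ c)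
    (l : Option (A ⊕ Option (Λ × Λ)) × Option (A ⊕ Option (Λ × Λ))) (h : Tr S c x q l q') :
    l.2.toList.length + pot c q' ≤ pot c q + (c + 1) * l.1.toList.length := by
  cases h with
  | growOut j j' h => simp [pot]; omega
  | growIn j => simp [pot]; omega
  | _ => simp [pot]

theorem outs_bound [Finite A] [Finite Λ] (c : ℕ) (x : A) (q q' : (edgeT S c x).Q)
    (ls : List (Option (A ⊕ Option (Λ × Λ)) × Option (A ⊕ Option (Λ × Λ))))
    (h : (edgeT S c x).Path q ls q') :
    (Transducer.outs ls).length ≤ pot c q + (c + 1) * (Transducer.ins ls).length := by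
  induction h with
  | nil q => simp [Transducer.outs]
  | cons h1 _ ih =>
    have := pot_step S c x _ _ _ h1
    simp only [Transducer.ins, Transducer.outs, List.flatMap_cons, List.length_append] at *
    rw [Nat.mul_add]
    omega

theorem tilingGraph_finite [Finite A] [Finite Λ] (c : ℕ) :
    (tilingGraph S c).FiniteOutDegree := by
  intro u
  refine Set.Finite.subset (s := Set.univ ×ˢ
    { v : List (A ⊕ Option (Λ × Λ)) | v.length ≤ 1 + (c + 1) * u.length }) ?_ ?_
  · exact Set.finite_univ.prod (List.finite_length_le _ _)
  · rintro ⟨x, v⟩ ⟨q, ls, h1, h2, rfl, rfl⟩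
    refine ⟨trivial, ?_⟩
    exact outs_bound S c x _ _ _ h1

/-- Reachability in the edge transducer. -/
def Reach [Finite A] [Finite Λ] (c : ℕ) (x : A) (q : St A Λ c)
    (u v : List (A ⊕ Option (Λ × Λ))) (q' : St A Λ c) : Prop :=
  ∃ ls, (edgeT S c x).Path q ls q' ∧ Transducer.ins ls = u ∧ Transducer.outs ls = v

theorem Reach.refl [Finite A] [Finite Λ] (c : ℕ) (x : A) (q : St A Λ c) :
    Reach S c x q [] [] q := ⟨[], .nil _, rfl, rfl⟩

theorem Reach.step [Finite A] [Finite Λ] {c : ℕ} {x : A} {q q' q'' : St A Λ c}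
    {a b : Option (A ⊕ Option (Λ × Λ))} {u v : List (A ⊕ Option (Λ × Λ))}
    (h : Tr S c x q (a, b) q') (hr : Reach S c x q' u v q'') :
    Reach S c x q (a.toList ++ u) (b.toList ++ v) q'' := by
  obtain ⟨ls, h1, rfl, rfl⟩ := hr
  exact ⟨(a, b) :: ls, .cons h h1, rfl, rfl⟩

theorem reach_grow_out [Finite A] [Finite Λ] (c : ℕ) (x : A) (q : St A Λ c)
    (u v : List (A ⊕ Option (Λ × Λ))) (h : Reach S c x (.grow 0) u v q) :
    ∀ j (hj : j < c + 1), Reach S c x (.grow ⟨j, hj⟩) u (List.replicate j (.inr none) ++ v) q := by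
  intro j
  induction j with
  | zero => intro _; exact h
  | succ j ih =>
    intro hj
    exact Reach.step S (Tr.growOut ⟨j + 1, hj⟩ ⟨j, by omega⟩ rfl) (ih (by omega))

theorem reach_grow [Finite A] [Finite Λ] (c : ℕ) (x : A) (N : ℕ) :
    Reach S c x (.grow 0) (vtx [] (List.replicate N none)) (vtx [] (List.replicate (c * N) none))
      (.grow 0) := by
  induction N with
  | zero => exact Reach.refl S c x _
  | succ N ih =>
    have h1 := reach_grow_out S c x _ _ _ ih c (by omega)
    have h2 := Reach.step S (Tr.growIn 0) h1
    have e : (none : Option (A ⊕ Option (Λ × Λ))).toList ++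
        (List.replicate c (.inr none) ++ vtx [] (List.replicate (c * N) none)) =
        vtx [] (List.replicate (c * (N + 1)) none) := by
      rw [Nat.mul_add, Nat.mul_one, Nat.add_comm]
      simp [vtx, List.replicate_append_replicate]
    rw [e] at h2
    exact h2

theorem edge_push [Finite A] [Finite Λ] (c : ℕ) (x : A) (s : List A) (N : ℕ) :
    (tilingGraph S c).Edge (vtx s (List.replicate N none)) x
      (vtx (x :: s) (List.replicate (c * N) none)) := by
  have h1 := Reach.step S Tr.cpEnd (reach_grow S c x N)
  have h2 : Reach S c x .cp (vtx s (List.replicate N none)) (vtx s (List.replicate (c * N) none))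
      (.grow 0) := by
    induction s with
    | nil => exact h1
    | cons a s ih => exact Reach.step S (Tr.cp a) ih
  obtain ⟨ls, g1, g2, g3⟩ := Reach.step S Tr.push h2
  exact ⟨.grow 0, ls, g1, trivial, g2, g3⟩

theorem reach_rw [Finite A] [Finite Λ] (c : ℕ) (x : A) (μ : Md A) (z : List (RowG Λ)) :
    ∀ p, CH (mstep S x μ) p z → ∃ q, finSt S c x q ∧
      Reach S c x (.rw μ p) (vtx [] (z.map Prod.fst)) (vtx [] (z.map fun g => some g.2)) q := by
  induction z with
  | nil => intro p h; exact ⟨.rw μ p, h, Reach.refl S c x _⟩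
  | cons g z ih =>
    rintro p ⟨h1, h2⟩
    obtain ⟨q, hq, hr⟩ := ih _ h2
    exact ⟨q, hq, Reach.step S (Tr.row μ p g h1) hr⟩

/-- The stack prefix popped by a mode. -/
def popped : Md A → List A
  | .sw => []
  | .sw2 y => [y]
  | .pop y => [y]

theorem edge_mode [Finite A] [Finite Λ] (c : ℕ) (x : A) (μ : Md A) (z : List (RowG Λ))
    (h : CH (mstep S x μ) none z) (s : List A) (k : ℕ) :
    (tilingGraph S c).Edge (vtx (popped μ ++ s) (List.replicate k none ++ z.map Prod.fst)) x
      (vtx s (z.map fun g => some g.2)) := by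
  obtain ⟨q, hq, hr⟩ := reach_rw S c x μ z none h
  have h1 : Reach S c x (.rw μ none) (vtx [] (List.replicate k none ++ z.map Prod.fst))
      (vtx [] (z.map fun g => some g.2)) q := by
    induction k with
    | zero => exact hr
    | succ k ih => exact Reach.step S (Tr.skip μ none) ih
  have h2 := Reach.step S (Tr.cmEnd μ) h1
  have h3 : Reach S c x (.cm μ) (vtx s (List.replicate k none ++ z.map Prod.fst))
      (vtx s (z.map fun g => some g.2)) q := by
    induction s with
    | nil => exact h2
    | cons a s ih => exact Reach.step S (Tr.cm μ a) ih
  have h4 : Reach S c x .start (vtx (popped μ ++ s) (List.replicate k none ++ z.map Prod.fst))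
      (vtx s (z.map fun g => some g.2)) q := by
    cases μ with
    | sw => exact Reach.step S Tr.toSw h3
    | sw2 y => exact Reach.step S (Tr.toSw2 y) h3
    | pop y => exact Reach.step S (Tr.toPop y) h3
  obtain ⟨ls, g1, g2, g3⟩ := h4
  exact ⟨q, ls, g1, hq, g2, g3⟩

end

section
variable {A Λ : Type} (S : TilingSystem A Λ)

/-- Step relation of the final automaton. -/
def fstep (p q : Option (Λ × Λ)) : Prop :=
  (p ≠ none ∨ q ≠ none) ∧
  (⟨none, p.map Prod.fst, none, q.map Prod.fst⟩ : Tile (Option Λ)) ∈ S.tiles ∧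
  (⟨p.map Prod.snd, none, q.map Prod.snd, none⟩ : Tile (Option Λ)) ∈ S.tiles

/-- The set of final vertices. -/
def finalSet : Set (List (A ⊕ Option (Λ × Λ))) :=
  { u | ∃ z : List (Λ × Λ), u = vtx [] (z.map some) ∧ CH (fstep S) none z }

open Classical in
/-- The automaton of final vertices. -/
noncomputable def finalDFA : DFA (A ⊕ Option (Λ × Λ)) (Option (Option (Λ × Λ))) where
  step := fun s l => match s, l with
    | some p, .inr (some g) => if fstep S p (some g) then some (some g) else none
    | _, _ => none
  start := some none
  accept := { s | ∃ p, s = some p ∧ fstep S p none }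

theorem finalDFA_none (u : List (A ⊕ Option (Λ × Λ))) :
    (finalDFA S).evalFrom none u = none := by
  induction u with
  | nil => rfl
  | cons l u ih => rw [DFA.evalFrom_cons]; exact ih

theorem finalDFA_accept (u : List (A ⊕ Option (Λ × Λ))) :
    ∀ p, (finalDFA S).evalFrom (some p) u ∈ (finalDFA S).accept ↔
      ∃ z : List (Λ × Λ), u = vtx [] (z.map some) ∧ CH (fstep S) p z := by
  have hnone : (none : Option (Option (Λ × Λ))) ∉ (finalDFA S).accept := by
    rintro ⟨p, h, _⟩
    simp at h
  induction u with
  | nil =>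
    intro p
    constructor
    · rintro ⟨p', h, h'⟩
      simp only [DFA.evalFrom_nil, Option.some.injEq] at h
      subst h
      exact ⟨[], rfl, h'⟩
    · rintro ⟨z, h, h'⟩
      cases z with
      | nil => exact ⟨p, rfl, h'⟩
      | cons g z => simp [vtx] at h
  | cons l u ih =>
    intro p
    rw [DFA.evalFrom_cons]
    rcases l with a | _ | g
    · have : (finalDFA S).step (some p) (.inl a) = none := rfl
      rw [this, finalDFA_none]
      refine ⟨fun h => absurd h hnone, ?_⟩
      rintro ⟨z, h, _⟩
      cases z <;> simp [vtx] at h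
    · have : (finalDFA S).step (some p) (.inr none) = none := rfl
      rw [this, finalDFA_none]
      refine ⟨fun h => absurd h hnone, ?_⟩
      rintro ⟨z, h, _⟩
      cases z <;> simp [vtx] at h
    · by_cases hg : fstep S p (some g)
      · have : (finalDFA S).step (some p) (.inr (some g)) = some (some g) := if_pos hg
        rw [this, ih]
        constructor
        · rintro ⟨z, rfl, h⟩
          exact ⟨g :: z, rfl, hg, h⟩
        · rintro ⟨z, h, h'⟩
          cases z with
          | nil => simp [vtx] at h
          | cons g' z =>
            simp only [vtx, List.map_nil, List.nil_append, List.map_cons, List.cons.injEq,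
              Sum.inr.injEq, Option.some.injEq] at h
            obtain ⟨rfl, rfl⟩ := h
            exact ⟨z, rfl, h'.2⟩
      · have : (finalDFA S).step (some p) (.inr (some g)) = none := if_neg hg
        rw [this, finalDFA_none]
        refine ⟨fun h => absurd h hnone, ?_⟩
        rintro ⟨z, h, h'⟩
        cases z with
        | nil => simp [vtx] at h
        | cons g' z =>
          simp only [vtx, List.map_nil, List.nil_append, List.map_cons, List.cons.injEq,
            Sum.inr.injEq, Option.some.injEq] at h
          obtain ⟨rfl, rfl⟩ := h
          exact absurd h'.1 hg

theorem regular_finalSet [Fintype Λ] : Regular (finalSet S) := by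
  refine ⟨Option (Option (Λ × Λ)), inferInstance, finalDFA S, ?_⟩
  ext u
  exact finalDFA_accept S u none

/-- Strip of adjacent columns reading `t`, with given first and last columns. -/
inductive Strip (n : ℕ) : List A → (ℕ → Option Λ) → (ℕ → Option Λ) → Prop
  | one (x : A) (f : ℕ → Option Λ) : IsCol S n x f → Strip n [x] f f
  | two (y x : A) (f g : ℕ → Option Λ) : IsCol S n y f → IsCol S n x g → HAdj S n f g →
      Strip n [y, x] f g
  | ext (y x : A) (t : List A) (f g f' g' : ℕ → Option Λ) : Strip n t f g →
      IsCol S n y f' → IsCol S n x g' → HAdj S n f' f → HAdj S n g g' →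
      Strip n (y :: (t ++ [x])) f' g'

theorem Strip.cols {n : ℕ} {t : List A} {f g : ℕ → Option Λ} (h : Strip S n t f g) :
    0 < t.length ∧ ∃ C : ℕ → ℕ → Option Λ, (∀ j a, t[j]? = some a → IsCol S n a (C j)) ∧
      (∀ j, j + 1 < t.length → HAdj S n (C j) (C (j + 1))) ∧ C 0 = f ∧ C (t.length - 1) = g := by
  induction h with
  | one x f hx =>
    refine ⟨by simp, fun _ => f, ?_, ?_, rfl, rfl⟩
    · intro j a hj
      rcases j with _ | j
      · simp at hj; subst hj; exact hx
      · simp at hj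
    · intro j hj
      simp at hj
  | two y x f g hy hx hfg =>
    refine ⟨by simp, fun j => if j = 0 then f else g, ?_, ?_, rfl, rfl⟩
    · intro j a hj
      rcases j with _ | _ | j
      · simp at hj; subst hj; exact hy
      · simp at hj; subst hj; exact hx
      · simp at hj
    · intro j hj
      obtain rfl : j = 0 := by simpa using hj
      exact hfg
  | ext y x t f g f' g' _ hy hx hl hr ih =>
    obtain ⟨hpos, C, h1, h2, h3, h4⟩ := ih
    refine ⟨by simp, fun j => if j = 0 then f' else if j ≤ t.length then C (j - 1) else g',
      ?_, ?_, rfl, ?_⟩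
    · intro j a hj
      rcases j with _ | j
      · simp at hj; subst hj; exact hy
      · simp only [List.getElem?_cons_succ] at hj
        simp only [Nat.add_eq_zero_iff, one_ne_zero, and_false, if_false, Nat.add_sub_cancel]
        split_ifs with h
        · rw [List.getElem?_append_left (by omega)] at hj
          exact h1 j a hj
        · rw [List.getElem?_append_right (by omega)] at hj
          have := List.mem_of_getElem? hj
          simp only [List.mem_singleton] at this
          subst this
          exact hx
    · intro j hj
      simp only [List.length_cons, List.length_append, List.length_nil] at hj
      rcases j with _ | j
      · simp only [if_true, show 0 + 1 ≤ t.length by omega]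
        simpa [h3] using hl
      · simp only [Nat.add_eq_zero_iff, one_ne_zero, and_false, if_false, Nat.add_sub_cancel,
          show j + 1 ≤ t.length by omega, if_true]
        split_ifs with h
        · exact h2 j (by omega)
        · rw [show j = t.length - 1 by omega, h4]
          exact hr
    · simp

/-- Invariant: vertices reachable by reading `w`. -/
def VInv (w : List A) (u : List (A ⊕ Option (Λ × Λ))) : Prop :=
  (∃ N, u = vtx w.reverse (List.replicate N none)) ∨
  ∃ (s : List A) (z : List (Λ × Λ)) (t : List A), u = vtx s (z.map some) ∧ z ≠ [] ∧
    w = s.reverse ++ t ∧ Strip S z.length t (pv (z.map Prod.fst)) (pv (z.map Prod.snd))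

theorem isCol_pv (x : A) (z : List Λ) (n : ℕ) (hn : z.length = n) (h : pv z 1 = some (S.emb x)) :
    IsCol S n x (pv z) := by
  subst hn
  exact ⟨h, pv_eq_none z⟩

theorem filterMap_fst_none (z : List (RowG Λ)) (h : ∀ g ∈ z, g.1 = none) :
    z.filterMap Prod.fst = [] := by
  rw [List.filterMap_eq_nil_iff]
  exact h

theorem filterMap_fst_some (z : List (RowG Λ)) (h : ∀ g ∈ z, g.1 ≠ none) :
    (z.filterMap Prod.fst).map some = z.map Prod.fst := by
  induction z with
  | nil => rfl
  | cons g z ih =>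
    have hg := h g (by simp)
    obtain ⟨_ | a, b⟩ := g
    · exact absurd rfl hg
    · simpa using ih fun g hg => h g (by simp [hg])

theorem CH_mstep_ne_nil (x : A) (μ : Md A) (z : List (RowG Λ)) (h : CH (mstep S x μ) none z) :
    z ≠ [] := by
  rintro rfl
  have := ((CH_mstep_iff S x μ []).1 h).2.1.1
  simp [pv] at this

theorem reduceOption_map_some {X : Type} (z : List X) : (z.map some).reduceOption = z := by
  simp [List.reduceOption, List.filterMap_map]

theorem reduceOption_replicate_none {X : Type} (N : ℕ) :
    (List.replicate N (none : Option X)).reduceOption = [] := by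
  rw [List.reduceOption, List.filterMap_eq_nil_iff]
  simp

theorem inv_step [Finite A] [Finite Λ] (c : ℕ) (w : List A) (x : A)
    (u v : List (A ⊕ Option (Λ × Λ))) (hu : VInv S w u) (h : (tilingGraph S c).Edge u x v) :
    VInv S (w ++ [x]) v := by
  have hs := spec_edge S c x u v h
  rcases hs with ⟨v', rfl, s, N, M, hu', rfl⟩ | ⟨s, z, t, hz, hu', rfl, ht⟩ |
    ⟨y, u', rfl, ⟨s, z, t, hz, rfl, rfl, ht⟩ | ⟨s, z, t, hz, rfl, rfl, ht⟩⟩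
  · rcases hu with ⟨N', rfl⟩ | ⟨s', z, t, rfl, hzn, _⟩
    · obtain ⟨rfl, -⟩ := vtx_inj hu'
      left
      exact ⟨M, by simp [vtx_cons]⟩
    · obtain ⟨-, h2⟩ := vtx_inj hu'
      cases z with
      | nil => exact absurd rfl hzn
      | cons g z => cases N <;> simp [List.replicate_succ] at h2
  · have hne := CH_mstep_ne_nil S _ _ _ hz
    obtain ⟨h1, h2, h3⟩ := (CH_mstep_iff S _ _ _).1 hz
    rcases hu with ⟨N', rfl⟩ | ⟨s', z', t', rfl, hzn, _⟩
    · obtain ⟨rfl, -⟩ := vtx_inj hu'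
      right
      refine ⟨w.reverse, z.map Prod.snd, [x], by simp [Function.comp_def], by simpa using hne,
        by simp, ?_⟩
      simp only [List.map_map, List.length_map, Function.comp_def]
      have e : z.map (fun g => g.2.1) = z.map (fun g => g.2.2) :=
        List.map_congr_left fun g hg => (h1 g hg).2
      rw [e]
      exact Strip.one _ _ (isCol_pv S _ _ _ (by simp) h2.2)
    · obtain ⟨-, rfl⟩ := vtx_inj hu'
      rw [reduceOption_map_some, filterMap_fst_none z (fun g hg => (h1 g hg).1)] at ht
      exact absurd ht hzn
  · have hne := CH_mstep_ne_nil S _ _ _ hz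
    obtain ⟨h1, h2, h3⟩ := (CH_mstep_iff S _ _ _).1 hz
    rw [← vtx_cons] at hu
    rcases hu with ⟨N', hu'⟩ | ⟨s', z', t', hu', hzn, _⟩
    · obtain ⟨hw, -⟩ := vtx_inj hu'
      have hw' : w = s.reverse ++ [y] := by
        rw [← List.reverse_reverse w, ← hw]; simp
      right
      refine ⟨s, z.map Prod.snd, [y, x], by simp [Function.comp_def], by simpa using hne,
        by simp [hw'], ?_⟩
      simp only [List.map_map, List.length_map, Function.comp_def]
      refine Strip.two _ _ _ _ (isCol_pv S _ _ _ (by simp) h2.1)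
        (isCol_pv S _ _ _ (by simp) h2.2) ?_
      intro i hi
      have := h3 i hi
      simp only [pv_map]
      exact this
    · obtain ⟨-, rfl⟩ := vtx_inj hu'
      rw [reduceOption_map_some, filterMap_fst_none z (fun g hg => h1 g hg)] at ht
      exact absurd ht hzn
  · have hne := CH_mstep_ne_nil S _ _ _ hz
    obtain ⟨h1, h2, h3⟩ := (CH_mstep_iff S _ _ _).1 hz
    have hsome := filterMap_fst_some z h1
    rw [← vtx_cons] at hu
    rcases hu with ⟨N', hu'⟩ | ⟨s', z', t', hu', hzn, rfl, hstrip⟩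
    · obtain ⟨-, rfl⟩ := vtx_inj hu'
      rw [reduceOption_replicate_none] at ht
      rw [← ht] at hsome
      simp at hsome
      exact absurd hsome.symm (by simpa using hne)
    · obtain ⟨rfl, rfl⟩ := vtx_inj hu'
      rw [reduceOption_map_some] at ht
      rw [← ht] at hsome
      have hlen : z'.length = z.length := by simpa using congrArg List.length hsome
      rw [hlen] at hstrip
      have hin : ∀ i, (pv z i).bind (fun g => g.1) = pv z' i := by
        intro i
        have e1 : (pv z i).map Prod.fst = (pv z' i).map some := by
          rw [← pv_map, ← pv_map, hsome]
        generalize pv z i = a at e1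
        generalize pv z' i = b at e1
        rcases a with _ | a <;> rcases b with _ | b <;> simp_all
      right
      refine ⟨s, z.map Prod.snd, y :: (t' ++ [x]), by simp [Function.comp_def],
        by simpa using hne, by simp, ?_⟩
      simp only [List.map_map, List.length_map, Function.comp_def]
      refine Strip.ext _ _ _ _ _ _ _ hstrip (isCol_pv S _ _ _ (by simp) h2.1)
        (isCol_pv S _ _ _ (by simp) h2.2) ?_ ?_
      · intro i hi
        have := (h3 i hi).1
        rw [hin, hin] at this
        simpa only [pv_map] using this
      · intro i hi
        have := (h3 i hi).2
        rw [hin, hin] at this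
        simpa only [pv_map] using this

theorem inv_final (w : List A) (u : List (A ⊕ Option (Λ × Λ))) (hu : VInv S w u)
    (hf : u ∈ finalSet S) : ∃ n p, FPic S w n p := by
  obtain ⟨z, rfl, hz⟩ := hf
  rw [CH_iff] at hz
  have hne : z ≠ [] := by
    rintro rfl
    have := (hz 0 le_rfl).1
    simp [pv] at this
  rcases hu with ⟨N, hu'⟩ | ⟨s, z', t, hu', hzn, rfl, hstrip⟩
  · obtain ⟨-, h2⟩ := vtx_inj hu'
    cases z with
    | nil => exact absurd rfl hne
    | cons g z => cases N <;> simp [List.replicate_succ] at h2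
  · obtain ⟨rfl, h2⟩ := vtx_inj hu'
    have : z = z' := by
      have := congrArg List.reduceOption h2
      rwa [reduceOption_map_some, reduceOption_map_some] at this
    subst this
    obtain ⟨hpos, C, h1, h2, h3, h4⟩ := hstrip.cols
    simp only [List.reverse_nil, List.nil_append]
    refine ⟨z.length, fun i j => if 1 ≤ j ∧ j ≤ t.length then C (j - 1) i else none,
      List.length_pos_iff.2 hne, hpos, ?_, ?_, ?_⟩
    · intro i j
      split_ifs with hj
      · rw [(h1 (j - 1) t[j - 1] (by simp)).2]
        omega
      · simp; omega
    · intro i hi j hj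
      have hz' := hz i hi
      rcases j with _ | j
      · simp only [show ¬ (1 ≤ 0 ∧ 0 ≤ t.length) by omega, if_false,
          show 1 ≤ 0 + 1 ∧ 0 + 1 ≤ t.length by omega, if_true]
        rw [show (0 + 1 - 1) = 0 from rfl, h3, pv_map, pv_map]
        exact hz'.2.1
      · simp only [Nat.add_sub_cancel]
        rw [if_pos (show 1 ≤ j + 1 ∧ j + 1 ≤ t.length by omega),
          if_pos (show 1 ≤ j + 1 ∧ j + 1 ≤ t.length by omega)]
        split_ifs with h
        · exact h2 j (by omega) i hi
        · rw [show j = t.length - 1 by omega, h4, pv_map, pv_map]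
          exact hz'.2.2
    · intro j a hj
      have hjl := (List.getElem?_eq_some_iff.1 hj).1
      simp only [show 1 ≤ j + 1 ∧ j + 1 ≤ t.length by omega, if_true, Nat.add_sub_cancel]
      exact (h1 j a hj).1

theorem lang_sound [Finite A] [Finite Λ] (c K : ℕ) (w : List A)
    (h : w ∈ (tilingGraph S c).Lang {vtx [] (List.replicate K none)} (finalSet S)) :
    w ∈ S.Lang := by
  rw [RationalGraph.mem_lang_iff] at h
  obtain ⟨vs, h0, hE, hf⟩ := h
  rw [TilingSystem.mem_lang_iff]
  have hinv : ∀ k ≤ w.length, VInv S (w.take k) (vs k) := by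
    intro k
    induction k with
    | zero => intro _; left; exact ⟨K, by simpa using h0⟩
    | succ k ih =>
      intro hk
      have := inv_step S c _ w[k] _ _ (ih (by omega)) (hE k w[k] (by simp))
      simpa using this
  have := hinv w.length le_rfl
  rw [List.take_length] at this
  exact inv_final S w _ this hf

end

theorem FPic.first_getElem {A Λ : Type} {S : TilingSystem A Λ} {w : List A} {n : ℕ}
    {p : ℕ → ℕ → Option Λ} (h : FPic S w n p) (j : ℕ) (hj : j < w.length) :
    p 1 (j + 1) = some (S.emb w[j]) := h.first j _ (by simp [hj])

theorem pv_range (n i : ℕ) : pv (List.range n) i = if 1 ≤ i ∧ i ≤ n then some (i - 1) else none := by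
  rcases i with _ | i
  · simp [pv]
  · rw [pv_succ]
    split_ifs with h
    · rw [List.getElem?_range (by omega)]; simp
    · rw [List.getElem?_eq_none (by rw [List.length_range]; omega)]

theorem take_reverse_succ {A : Type} (w : List A) (k : ℕ) (hk : k < w.length) :
    (w.take (k + 1)).reverse = w[k] :: (w.take k).reverse := by
  rw [List.take_succ_eq_append_getElem hk, List.reverse_append]; rfl

theorem lang_complete {A Λ : Type} [Finite A] [Fintype Λ] (S : TilingSystem A Λ) (K : ℕ)
    (hK : K = Fintype.card Λ + 1) (w : List A) (h : w ∈ S.Lang) :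
    w ∈ (tilingGraph S (K * K)).Lang {vtx [] (List.replicate K none)} (finalSet S) := by
  rw [TilingSystem.mem_lang_iff] at h
  obtain ⟨n, p, hp, hn⟩ := FPic.exists_bounded S w h
  rw [← hK] at hn
  have hnp := hp.npos
  have hmp := hp.mpos
  obtain ⟨m, hm⟩ : ∃ m, m = w.length := ⟨_, rfl⟩
  obtain ⟨l0, -⟩ : ∃ l, p 1 1 = some l :=
    Option.ne_none_iff_exists'.1 fun h => (hp.shape 1 1).1 h (by omega)
  obtain ⟨f, hf⟩ : ∃ f : ℕ → ℕ → Λ, ∀ j, 1 ≤ j → j ≤ m → ∀ i,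
      (pv (List.range n) i).map (fun i => f i j) = p i j := by
    refine ⟨fun i j => (p (i + 1) j).getD l0, ?_⟩
    intro j hj1 hj2 i
    rw [pv_range]
    split_ifs with hi
    · obtain ⟨l, hl⟩ : ∃ l, p i j = some l :=
        Option.ne_none_iff_exists'.1 fun h => (hp.shape i j).1 h (by omega)
      simp [show i - 1 + 1 = i by omega, hl]
    · symm
      simp only [Option.map_none]
      rw [hp.shape]; omega
  have hf' : ∀ j, 1 ≤ j → j ≤ m → ∀ i,
      (pv (List.range n) i).bind (fun i => some (f i j)) = p i j := by
    intro j hj1 hj2 i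
    rw [← hf j hj1 hj2 i]
    cases pv (List.range n) i <;> rfl
  rw [RationalGraph.mem_lang_iff]
  refine ⟨fun k => if 2 * k ≤ m then vtx (w.take k).reverse (List.replicate (K ^ (2 * k + 1)) none)
    else vtx (w.take (m - k)).reverse
      ((List.range n).map fun i => some (f i (m - k + 1), f i k)), by simp, ?_, ?_⟩
  · intro k a hk
    have hkm := (List.getElem?_eq_some_iff.1 hk).1
    have hfirst := hp.first k a hk
    by_cases h1 : 2 * (k + 1) ≤ m
    · simp only [h1, show 2 * k ≤ m by omega, if_true]
      have := edge_push S (K * K) a (w.take k).reverse (K ^ (2 * k + 1))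
      rw [take_reverse_succ w k hkm,
        show K ^ (2 * (k + 1) + 1) = K * K * K ^ (2 * k + 1) by ring]
      obtain rfl : w[k] = a := (List.getElem?_eq_some_iff.1 hk).2
      exact this
    · simp only [h1, if_false]
      by_cases h2 : 2 * k ≤ m
      · simp only [h2, if_true]
        have hKpos : 0 < K := by omega
        have hle : n ≤ K ^ (2 * k + 1) :=
          hn.trans (Nat.pow_le_pow_right hKpos (by omega))
        have hrep : ∀ g : ℕ → Λ × Λ, List.replicate (K ^ (2 * k + 1)) none =
            List.replicate (K ^ (2 * k + 1) - n) none ++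
              ((List.range n).map (fun i => ((none, g i) : RowG Λ))).map Prod.fst := by
          intro g
          rw [List.map_map]
          have : (Prod.fst ∘ fun i => ((none, g i) : RowG Λ)) = Function.const ℕ none := rfl
          rw [this, List.map_const, List.length_range, ← List.replicate_add]
          congr 1; omega
        by_cases h3 : m = 2 * k + 1
        · have := edge_mode S (K * K) a .sw
            ((List.range n).map (fun i => ((none, (f i (k + 1), f i (k + 1))) : RowG Λ))) ?_
            (w.take k).reverse (K ^ (2 * k + 1) - n)
          · rw [← hrep] at this
            rw [show m - (k + 1) = k by omega]
            simpa [popped, Function.comp_def] using this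
          · rw [CH_mstep_iff]
            refine ⟨by simp [shapeM], ?_, fun _ _ => trivial⟩
            simp only [List.map_map, pv_map, Function.comp_def, leftLetter]
            rw [hf _ (by omega) (by omega), hfirst]
            simp
        · obtain ⟨r, rfl⟩ : ∃ r, k = r + 1 := ⟨k - 1, by omega⟩
          have := edge_mode S (K * K) a (.sw2 (w[r]'(by omega)))
            ((List.range n).map (fun i => ((none, (f i (r + 1), f i (r + 1 + 1))) : RowG Λ))) ?_
            (w.take r).reverse (K ^ (2 * (r + 1) + 1) - n)
          · rw [← hrep] at this
            rw [show m - (r + 1 + 1) = r by omega, take_reverse_succ w r (by omega)]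
            simpa [popped, Function.comp_def] using this
          · rw [CH_mstep_iff]
            refine ⟨by simp [shapeM], ?_, ?_⟩
            · simp only [List.map_map, pv_map, Function.comp_def, leftLetter]
              rw [hf _ (by omega) (by omega), hf _ (by omega) (by omega), hfirst,
                hp.first_getElem r (by omega)]
              simp
            · intro i hi
              simp only [List.length_map, List.length_range] at hi
              simp only [tileM, pv_map, Option.map_map, Function.comp_def]
              simp only [hf (r + 1) (by omega) (by omega), hf (r + 1 + 1) (by omega) (by omega)]
              exact hp.tile i hi (r + 1) (by omega)
      · simp only [h2, if_false]
        obtain ⟨r, hr⟩ : ∃ r, m - k = r + 1 := ⟨m - k - 1, by omega⟩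
        have := edge_mode S (K * K) a (.pop (w[r]'(by omega)))
          ((List.range n).map (fun i =>
            ((some (f i (r + 1 + 1), f i k), (f i (r + 1), f i (k + 1))) : RowG Λ))) ?_
          (w.take r).reverse 0
        · rw [show m - (k + 1) = r by omega, hr, take_reverse_succ w r (by omega)]
          simpa [popped, Function.comp_def] using this
        · rw [CH_mstep_iff]
          refine ⟨by simp [shapeM], ?_, ?_⟩
          · simp only [List.map_map, pv_map, Function.comp_def, leftLetter]
            rw [hf _ (by omega) (by omega), hf _ (by omega) (by omega), hfirst,
              hp.first_getElem r (by omega)]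
            simp
          · intro i hi
            simp only [List.length_map, List.length_range] at hi
            simp only [tileM, pv_map, Option.map_map, Function.comp_def, Option.bind_map,
              Option.map_bind, Option.map_some]
            simp only [hf (r + 1) (by omega) (by omega), hf' (r + 1 + 1) (by omega) (by omega),
              hf' k (by omega) (by omega), hf (k + 1) (by omega) (by omega)]
            exact ⟨hp.tile i hi (r + 1) (by omega), hp.tile i hi k (by omega)⟩
  · rw [← hm]
    simp only [show ¬ (2 * m ≤ m) by omega, if_false]
    refine ⟨(List.range n).map fun i => (f i 1, f i m), by simp [Function.comp_def], ?_⟩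
    rw [CH_iff]
    intro i hi
    simp only [List.length_map, List.length_range] at hi
    refine ⟨?_, ?_, ?_⟩
    · simp only [ne_eq, pv_eq_none, List.length_map, List.length_range]
      omega
    · simp only [pv_map, Option.map_map, Function.comp_def]
      simp only [hf 1 le_rfl (by omega)]
      have := hp.tile i hi 0 (by omega)
      rwa [(hp.shape i 0).2 (by omega), (hp.shape (i + 1) 0).2 (by omega)] at this
    · simp only [pv_map, Option.map_map, Function.comp_def]
      simp only [hf m (by omega) (by omega)]
      have := hp.tile i hi m (by omega)
      rwa [(hp.shape i (m + 1)).2 (by omega), (hp.shape (i + 1) (m + 1)).2 (by omega)] at this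

/-- A language `L` of nonempty words is the path language of some
rational graph of finite out-degree from a unique initial vertex to a rational set of
final vertices iff `L` is the word language of some tiling system (i.e. is
context-sensitive). -/
theorem finite_degree_rational_lang_iff_tiling {A : Type} [Fintype A]
    (L : Set (List A)) (hL : ∀ w ∈ L, w ≠ []) :
    (∃ (Γ : Type) (_ : Fintype Γ) (H : RationalGraph A Γ) (i : List Γ)
        (F : Set (List Γ)),
        H.FiniteOutDegree ∧ Regular F ∧ H.Lang {i} F = L) ↔
      (∃ (Λ : Type) (_ : Fintype Λ) (S : TilingSystem A Λ), S.Lang = L) := by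
  classical
  constructor
  · rintro ⟨Γ, _, H, i, F, _, hF, rfl⟩
    exact tiling_of_graph H i F hF (fun h => hL _ h rfl)
  · rintro ⟨Λ, _, S, rfl⟩
    let K := Fintype.card Λ + 1
    refine ⟨A ⊕ Option (Λ × Λ), inferInstance, tilingGraph S (K * K),
      vtx [] (List.replicate K none), finalSet S, tilingGraph_finite S _, regular_finalSet S, ?_⟩
    ext w
    exact ⟨lang_sound S _ K w, lang_complete S K rfl w⟩
end
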